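/- arXiv:nlin/0108054 — 2 statements merged into one kernel-verified Lean document; each statement's English description precedes it below -/
import Mathlib

section
/- Let τ ∈ ℂ with Im τ > 0, and let Θ(z) = ∑_{n∈ℤ} exp(πi·n²·τ + 2πi·n·z) be the Jacobi theta function. Then for z ∈ ℂ, Θ(z) = 0 if and only if there exist integers m and n with z = (1+τ)/2 + m + n·τ. In particular Θ(1/2) ≠ 0 and Θ(z) ≠ 0 whenever z ∉ (1+τ)/2 + ℤ + τℤ. -/
open Complex

open Filter Topology

/-- The finite q-Pochhammer product. -/
noncomputable def qpoch (p : ℂ) (k : ℕ) : ℂ := ∏ i ∈ Finset.range k, (1 + -(p ^ (i + 1)))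

/-- Reciprocal of the q-Pochhammer product, extended by zero to negative indices. -/
noncomputable def qinv (p : ℂ) (k : ℤ) : ℂ := if 0 ≤ k then (qpoch p k.toNat)⁻¹ else 0

lemma one_add_neg_pow_ne {p : ℂ} (hp : ‖p‖ < 1) (i : ℕ) : (1 + -(p ^ (i + 1)) : ℂ) ≠ 0 := by
  intro h
  have h1 : p ^ (i + 1) = 1 := by linear_combination -h
  have h2 : ‖p‖ ^ (i + 1) = 1 := by rw [← norm_pow, h1, norm_one]
  have h3 : ‖p‖ ^ (i + 1) < 1 := pow_lt_one₀ (norm_nonneg _) hp (by omega)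
  linarith

lemma qpoch_ne {p : ℂ} (hp : ‖p‖ < 1) (k : ℕ) : qpoch p k ≠ 0 :=
  Finset.prod_ne_zero_iff.mpr fun i _ => one_add_neg_pow_ne hp i

lemma qinv_rec {p : ℂ} (hp : ‖p‖ < 1) (k : ℤ) :
    qinv p k = (1 - p ^ (k + 1)) * qinv p (k + 1) := by
  unfold qinv
  rcases lt_trichotomy k (-1) with h | h | h
  · rw [if_neg (by omega), if_neg (by omega), mul_zero]
  · subst h; simp
  · rw [if_pos (by omega), if_pos (by omega)]
    obtain ⟨n, rfl⟩ := Int.eq_ofNat_of_zero_le (show 0 ≤ k by omega)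
    have e : ((n : ℤ) + 1).toNat = n + 1 := by omega
    have e2 : p ^ ((n : ℤ) + 1) = p ^ (n + 1) := by exact_mod_cast zpow_natCast p (n + 1)
    rw [e, e2, Int.toNat_natCast]
    have h1 := qpoch_ne hp n
    have h2 := one_add_neg_pow_ne hp n
    have h3 : qpoch p (n + 1) = qpoch p n * (1 + -(p ^ (n + 1))) := Finset.prod_range_succ _ _
    rw [h3]
    have h4 : (1 - p ^ (n + 1) : ℂ) = 1 + -(p ^ (n + 1)) := by ring
    rw [h4]
    field_simp

/-- The q-binomial-type coefficients. -/
noncomputable def qcoef (p : ℂ) (N : ℕ) (n : ℤ) : ℂ :=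
  qpoch p (2 * N) * (qinv p (N + n) * qinv p (N - n))

lemma qcoef_rec {p : ℂ} (hp0 : p ≠ 0) (hp : ‖p‖ < 1) (N : ℕ) (n : ℤ) :
    qcoef p (N + 1) n = (1 + p ^ (2 * N + 1)) * qcoef p N n
      + p ^ ((N : ℤ) + 1 - n) * qcoef p N (n - 1)
      + p ^ ((N : ℤ) + 1 + n) * qcoef p N (n + 1) := by
  unfold qcoef
  have a0 := qinv_rec hp (N + n)
  have a1 := qinv_rec hp (N + n - 1)
  have b0 := qinv_rec hp (N - n)
  have b1 := qinv_rec hp (N - n - 1)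
  have h3 : qpoch p (2 * (N + 1)) = qpoch p (2 * N) * (1 - p ^ (2 * N + 1))
      * (1 - p ^ (2 * N + 2)) := by
    have : 2 * (N + 1) = 2 * N + 1 + 1 := by ring
    rw [this]
    unfold qpoch
    rw [Finset.prod_range_succ, Finset.prod_range_succ]
    ring
  rw [show (N : ℤ) + n - 1 + 1 = N + n by ring] at a1
  rw [show (N : ℤ) - n - 1 + 1 = N - n by ring] at b1
  rw [h3]
  push_cast
  rw [show (N : ℤ) + 1 + n = N + n + 1 by ring, show (N : ℤ) + 1 - n = N - n + 1 by ring,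
    show (N : ℤ) + (n - 1) = N + n - 1 by ring, show (N : ℤ) - (n - 1) = N - n + 1 by ring,
    show (N : ℤ) + (n + 1) = N + n + 1 by ring, show (N : ℤ) - (n + 1) = N - n - 1 by ring,
    a1, b1, a0, b0]
  have hab : p ^ (2 * N) = p ^ ((N : ℤ) + n) * p ^ ((N : ℤ) - n) := by
    rw [← zpow_add₀ hp0, ← zpow_natCast]
    congr 1
    push_cast
    ring
  rw [pow_succ p (2 * N), pow_add p (2 * N) 2, hab, zpow_add_one₀ hp0, zpow_add_one₀ hp0]
  ring

/-- Finite Jacobi triple product. -/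
lemma finite_triple {q x : ℂ} (hq0 : q ≠ 0) (hq : ‖q‖ < 1) (hx : x ≠ 0) (N : ℕ) :
    HasSum (fun n : ℤ => qcoef (q ^ 2) N n * (q ^ (n ^ 2) * x ^ n))
      (∏ j ∈ Finset.range N, ((1 + x * q ^ (2 * j + 1)) * (1 + x⁻¹ * q ^ (2 * j + 1)))) := by
  have hp0 : q ^ 2 ≠ 0 := pow_ne_zero _ hq0
  have hp : ‖q ^ 2‖ < 1 := by
    rw [norm_pow]; exact pow_lt_one₀ (norm_nonneg _) hq (by norm_num)
  induction N with
  | zero =>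
    have := hasSum_single (f := fun n : ℤ => qcoef (q ^ 2) 0 n * (q ^ (n ^ 2) * x ^ n)) 0 (by
      intro n hn
      have : qcoef (q ^ 2) 0 n = 0 := by
        unfold qcoef qinv
        rcases lt_or_gt_of_ne hn with h | h
        · rw [if_neg (by push_cast; omega)]; ring
        · rw [if_neg (c := 0 ≤ ((0 : ℕ) : ℤ) - n) (by push_cast; omega)]; ring
      simp only [this, zero_mul])
    simpa [qcoef, qinv, qpoch] using this
  | succ N ih =>
    rw [Finset.prod_range_succ]
    have s1 := ih.mul_left (1 + q ^ (4 * N + 2))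
    have s2 := ((Equiv.subRight (1 : ℤ)).hasSum_iff.mpr ih).mul_left (q ^ (2 * N + 1) * x)
    have s3 := ((Equiv.addRight (1 : ℤ)).hasSum_iff.mpr ih).mul_left (q ^ (2 * N + 1) * x⁻¹)
    have s := (s1.add s2).add s3
    convert s using 1
    · rfl
    · funext n
      simp only [Function.comp, Equiv.subRight_apply, Equiv.coe_addRight]
      rw [qcoef_rec hp0 hp]
      have e1 : (q ^ 2) ^ (2 * N + 1) = q ^ (4 * N + 2) := by rw [← pow_mul]; congr 1; ring
      have e2 : (q ^ 2) ^ ((N : ℤ) + 1 - n) * q ^ (n ^ 2)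
          = q ^ (2 * N + 1) * q ^ ((n - 1) ^ 2) := by
        rw [← zpow_natCast q 2, ← zpow_mul, ← zpow_natCast q (2 * N + 1), ← zpow_add₀ hq0,
          ← zpow_add₀ hq0]
        congr 1; push_cast; ring
      have e3 : (q ^ 2) ^ ((N : ℤ) + 1 + n) * q ^ (n ^ 2)
          = q ^ (2 * N + 1) * q ^ ((n + 1) ^ 2) := by
        rw [← zpow_natCast q 2, ← zpow_mul, ← zpow_natCast q (2 * N + 1), ← zpow_add₀ hq0,
          ← zpow_add₀ hq0]
        congr 1; push_cast; ring
      have e4 : x ^ n = x * x ^ (n - 1) := by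
        rw [zpow_sub_one₀ hx]; field_simp
      have e5 : x ^ n = x⁻¹ * x ^ (n + 1) := by
        rw [zpow_add_one₀ hx]; field_simp
      rw [e1]
      linear_combination (qcoef (q ^ 2) N (n - 1) * x ^ n) * e2
        + (qcoef (q ^ 2) N (n + 1) * x ^ n) * e3
        + (q ^ (2 * N + 1) * q ^ ((n - 1) ^ 2) * qcoef (q ^ 2) N (n - 1)) * e4
        + (q ^ (2 * N + 1) * q ^ ((n + 1) ^ 2) * qcoef (q ^ 2) N (n + 1)) * e5
    · have : q ^ (4 * N + 2) = q ^ (2 * N + 1) * q ^ (2 * N + 1) := by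
        rw [← pow_add]; congr 1; ring
      rw [this]
      have hxx : x * x⁻¹ = 1 := mul_inv_cancel₀ hx
      linear_combination (∏ j ∈ Finset.range N,
        ((1 + x * q ^ (2 * j + 1)) * (1 + x⁻¹ * q ^ (2 * j + 1)))) *
        (q ^ (2 * N + 1) * q ^ (2 * N + 1)) * hxx

lemma qpoch_lim {p : ℂ} (hp : ‖p‖ < 1) :
    ∃ L : ℂ, L ≠ 0 ∧ Tendsto (qpoch p) atTop (𝓝 L) := by
  have hs : Summable fun i : ℕ => ‖-(p ^ (i + 1))‖ := by
    simp only [norm_neg, norm_pow]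
    exact (summable_nat_add_iff 1).mpr (summable_geometric_of_lt_one (norm_nonneg _) hp)
  exact ⟨_, tprod_one_add_ne_zero_of_summable (one_add_neg_pow_ne hp) hs,
    (multipliable_one_add_of_summable hs).tendsto_prod_tprod_nat⟩

lemma qcoef_lim {p : ℂ} (hp : ‖p‖ < 1) :
    ∃ L : ℂ, L ≠ 0 ∧ (∀ n : ℤ, Tendsto (fun N => qcoef p N n) atTop (𝓝 L)) ∧
      ∃ C : ℝ, ∀ N n, ‖qcoef p N n‖ ≤ C := by
  obtain ⟨L, hL, hlim⟩ := qpoch_lim hp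
  have hinv := hlim.inv₀ hL
  have hq : Tendsto (qinv p) atTop (𝓝 L⁻¹) := by
    have h1 : Tendsto (fun k : ℤ => (qpoch p k.toNat)⁻¹) atTop (𝓝 L⁻¹) := by
      refine hinv.comp (tendsto_atTop.mpr fun b => ?_)
      filter_upwards [eventually_ge_atTop (b : ℤ)] with k hk
      omega
    refine h1.congr' ?_
    filter_upwards [eventually_ge_atTop (0 : ℤ)] with k hk
    simp [qinv, hk]
  refine ⟨L * (L⁻¹ * L⁻¹), by simp [hL], fun n => ?_, ?_⟩
  · unfold qcoef
    refine Tendsto.mul ?_ (Tendsto.mul ?_ ?_)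
    · refine hlim.comp (tendsto_atTop.mpr fun b => ?_)
      filter_upwards [eventually_ge_atTop b] with k hk
      omega
    · refine hq.comp (tendsto_atTop.mpr fun b => ?_)
      filter_upwards [eventually_ge_atTop (b - n).toNat] with k hk
      omega
    · refine hq.comp (tendsto_atTop.mpr fun b => ?_)
      filter_upwards [eventually_ge_atTop (b + n).toNat] with k hk
      omega
  · obtain ⟨A, hA⟩ := (Metric.isBounded_range_of_tendsto _ hlim).exists_norm_le
    obtain ⟨B, hB⟩ := (Metric.isBounded_range_of_tendsto _ hinv).exists_norm_le
    have hA2 : ∀ k, ‖qpoch p k‖ ≤ A := fun k => hA _ ⟨k, rfl⟩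
    have hB2 : ∀ k : ℕ, ‖(qpoch p k)⁻¹‖ ≤ B := fun k => hB _ ⟨k, rfl⟩
    have hA0 : 0 ≤ A := (norm_nonneg _).trans (hA2 0)
    have hB0 : 0 ≤ B := (norm_nonneg _).trans (hB2 0)
    have hB3 : ∀ k : ℤ, ‖qinv p k‖ ≤ B := by
      intro k
      unfold qinv
      split_ifs
      · exact hB2 _
      · simpa using hB0
    refine ⟨A * (B * B), fun N n => ?_⟩
    unfold qcoef
    rw [norm_mul, norm_mul]
    gcongr
    · exact hA2 _
    · exact hB3 _
    · exact hB3 _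

/-- Jacobi triple product, up to a nonzero constant. -/
lemma triple_lim {q x : ℂ} (hq0 : q ≠ 0) (hq : ‖q‖ < 1) (hx : x ≠ 0)
    (hs : Summable fun n : ℤ => q ^ (n ^ 2) * x ^ n) :
    ∃ L : ℂ, L ≠ 0 ∧ Tendsto (fun N => ∏ j ∈ Finset.range N,
      ((1 + x * q ^ (2 * j + 1)) * (1 + x⁻¹ * q ^ (2 * j + 1)))) atTop
      (𝓝 (L * ∑' n : ℤ, q ^ (n ^ 2) * x ^ n)) := by
  have hp : ‖q ^ 2‖ < 1 := by
    rw [norm_pow]; exact pow_lt_one₀ (norm_nonneg _) hq (by norm_num)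
  obtain ⟨L, hL, hlim, C, hC⟩ := qcoef_lim hp
  refine ⟨L, hL, ?_⟩
  rw [← tsum_mul_left]
  have := tendsto_tsum_of_dominated_convergence (𝓕 := atTop)
    (f := fun (N : ℕ) (n : ℤ) => qcoef (q ^ 2) N n * (q ^ (n ^ 2) * x ^ n))
    (g := fun n : ℤ => L * (q ^ (n ^ 2) * x ^ n))
    (bound := fun n : ℤ => C * ‖q ^ (n ^ 2) * x ^ n‖) (hs.norm.mul_left C)
    (fun n => (hlim n).mul_const _)
    (Eventually.of_forall fun N n => by
      rw [norm_mul]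
      exact mul_le_mul_of_nonneg_right (hC N n) (norm_nonneg _))
  refine this.congr fun N => (finite_triple hq0 hq hx N).tsum_eq

lemma triple_zero_iff {q x : ℂ} (hq0 : q ≠ 0) (hq : ‖q‖ < 1) (hx : x ≠ 0)
    (hs : Summable fun n : ℤ => q ^ (n ^ 2) * x ^ n) :
    (∑' n : ℤ, q ^ (n ^ 2) * x ^ n) = 0 ↔
      ∃ j : ℕ, 1 + x * q ^ (2 * j + 1) = 0 ∨ 1 + x⁻¹ * q ^ (2 * j + 1) = 0 := by
  obtain ⟨L, hL, hlim⟩ := triple_lim hq0 hq hx hs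
  have hsum : ∀ y : ℂ, Summable fun j : ℕ => ‖y * q ^ (2 * j + 1)‖ := by
    intro y
    have : (fun j : ℕ => ‖y * q ^ (2 * j + 1)‖) = fun j : ℕ => (‖y‖ * ‖q‖) * (‖q‖ ^ 2) ^ j := by
      funext j
      rw [norm_mul, norm_pow, pow_succ, pow_mul]; ring
    rw [this]
    exact (summable_geometric_of_lt_one (by positivity)
      (pow_lt_one₀ (norm_nonneg _) hq (by norm_num))).mul_left _
  constructor
  · intro h0
    by_contra! hne
    have n1 := tprod_one_add_ne_zero_of_summable (fun j => (hne j).1) (hsum x)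
    have n2 := tprod_one_add_ne_zero_of_summable (fun j => (hne j).2) (hsum x⁻¹)
    have t1 := (multipliable_one_add_of_summable (hsum x)).tendsto_prod_tprod_nat
    have t2 := (multipliable_one_add_of_summable (hsum x⁻¹)).tendsto_prod_tprod_nat
    have t := t1.mul t2
    simp only [← Finset.prod_mul_distrib] at t
    have := tendsto_nhds_unique t hlim
    rw [h0, mul_zero] at this
    exact mul_ne_zero n1 n2 this
  · rintro ⟨j, hj⟩
    have hz : (1 + x * q ^ (2 * j + 1)) * (1 + x⁻¹ * q ^ (2 * j + 1)) = 0 := by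
      rcases hj with h | h <;> simp [h]
    have : Tendsto (fun N => ∏ j ∈ Finset.range N,
      ((1 + x * q ^ (2 * j + 1)) * (1 + x⁻¹ * q ^ (2 * j + 1)))) atTop (𝓝 0) := by
      refine tendsto_const_nhds.congr' ?_
      filter_upwards [eventually_gt_atTop j] with N hN
      exact (Finset.prod_eq_zero (Finset.mem_range.mpr hN) hz).symm
    have h := tendsto_nhds_unique hlim this
    exact (mul_eq_zero.mp h).resolve_left hL

lemma one_add_exp_eq_zero_iff (w : ℂ) :
    1 + Complex.exp w = 0 ↔ ∃ m : ℤ, w = Real.pi * I + m * (2 * Real.pi * I) := by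
  rw [← Complex.exp_eq_exp_iff_exists_int, Complex.exp_pi_mul_I]
  constructor
  · intro h; linear_combination h
  · intro h; rw [h]; ring

lemma theta_zero_iff (τ : ℂ) (hτ : 0 < τ.im) (z : ℂ) :
      (∑' k : ℤ, Complex.exp (Real.pi * I * (k : ℂ) ^ 2 * τ +
        2 * Real.pi * I * (k : ℂ) * z)) = 0 ↔
      ∃ m n : ℤ, z = (1 + τ) / 2 + (m : ℂ) + (n : ℂ) * τ := by
  have hterm : ∀ k : ℤ, Complex.exp (Real.pi * I * (k : ℂ) ^ 2 * τ +
        2 * Real.pi * I * (k : ℂ) * z) =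
      Complex.exp (Real.pi * I * τ) ^ (k ^ 2) * Complex.exp (2 * Real.pi * I * z) ^ k := by
    intro k
    rw [← Complex.exp_int_mul, ← Complex.exp_int_mul, ← Complex.exp_add]
    congr 1; push_cast; ring
  have hs : Summable fun k : ℤ =>
      Complex.exp (Real.pi * I * τ) ^ (k ^ 2) * Complex.exp (2 * Real.pi * I * z) ^ k := by
    refine ((summable_jacobiTheta₂_term_iff z τ).mpr hτ).congr fun k => ?_
    rw [← hterm, jacobiTheta₂_term, add_comm]
  have hq : ‖Complex.exp (Real.pi * I * τ)‖ < 1 := by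
    rw [Complex.norm_exp, Real.exp_lt_one_iff]
    simp
    positivity
  simp only [hterm]
  rw [triple_zero_iff (Complex.exp_ne_zero _) hq (Complex.exp_ne_zero _) hs]
  have hpi : (Real.pi : ℂ) * I ≠ 0 := by simp [Real.pi_ne_zero]
  have f1 : ∀ j : ℕ, Complex.exp (2 * Real.pi * I * z) * Complex.exp (Real.pi * I * τ) ^ (2 * j + 1)
      = Complex.exp (Real.pi * I * (2 * z + (2 * j + 1) * τ)) := by
    intro j
    rw [← Complex.exp_nat_mul, ← Complex.exp_add]
    congr 1; push_cast; ring
  have f2 : ∀ j : ℕ,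
      (Complex.exp (2 * Real.pi * I * z))⁻¹ * Complex.exp (Real.pi * I * τ) ^ (2 * j + 1)
      = Complex.exp (Real.pi * I * (-(2 * z) + (2 * j + 1) * τ)) := by
    intro j
    rw [← Complex.exp_nat_mul, ← Complex.exp_neg, ← Complex.exp_add]
    congr 1; push_cast; ring
  simp only [f1, f2, one_add_exp_eq_zero_iff]
  constructor
  · rintro ⟨j, ⟨m, h⟩ | ⟨m, h⟩⟩
    · refine ⟨m, -j - 1, ?_⟩
      have h2 : 2 * z + (2 * j + 1) * τ = 1 + 2 * m := by
        apply mul_left_cancel₀ hpi; rw [h]; ring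
      push_cast
      linear_combination h2 / 2
    · refine ⟨-m - 1, j, ?_⟩
      have h2 : -(2 * z) + (2 * j + 1) * τ = 1 + 2 * m := by
        apply mul_left_cancel₀ hpi; rw [h]; ring
      push_cast
      linear_combination -h2 / 2
  · rintro ⟨m, n, rfl⟩
    rcases le_or_gt 0 n with hn | hn
    · obtain ⟨j, rfl⟩ := Int.eq_ofNat_of_zero_le hn
      refine ⟨j, Or.inr ⟨-m - 1, ?_⟩⟩
      push_cast; ring
    · obtain ⟨j, hj⟩ := Int.eq_ofNat_of_zero_le (show 0 ≤ -n - 1 by omega)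
      obtain rfl : n = -j - 1 := by omega
      refine ⟨j, Or.inl ⟨m, ?_⟩⟩
      push_cast; ring

/-- The zero set of the Jacobi theta function `Θ(z) = ∑_{n∈ℤ} exp(πin²τ + 2πinz)`
is exactly `(1+τ)/2 + ℤ + τℤ`; in particular `Θ(1/2) ≠ 0`. -/
theorem theta_zero_set (τ : ℂ) (hτ : 0 < τ.im) :
    (∀ z : ℂ,
      (∑' k : ℤ, Complex.exp (Real.pi * I * (k : ℂ) ^ 2 * τ +
        2 * Real.pi * I * (k : ℂ) * z)) = 0 ↔
      ∃ m n : ℤ, z = (1 + τ) / 2 + (m : ℂ) + (n : ℂ) * τ) ∧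
    (∑' k : ℤ, Complex.exp (Real.pi * I * (k : ℂ) ^ 2 * τ +
      2 * Real.pi * I * (k : ℂ) * (1 / 2 : ℂ))) ≠ 0 ∧
    (∀ z : ℂ, (¬∃ m n : ℤ, z = (1 + τ) / 2 + (m : ℂ) + (n : ℂ) * τ) →
      (∑' k : ℤ, Complex.exp (Real.pi * I * (k : ℂ) ^ 2 * τ +
        2 * Real.pi * I * (k : ℂ) * z)) ≠ 0) := by
  refine ⟨theta_zero_iff τ hτ, ?_, fun z hz h => hz ((theta_zero_iff τ hτ z).mp h)⟩
  intro h
  obtain ⟨m, n, h⟩ := (theta_zero_iff τ hτ (1 / 2)).mp h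
  have h2 := congrArg Complex.im h
  have h3 : τ.im * (1 + 2 * (n : ℝ)) = 0 := by
    have e : (1 / 2 : ℂ) = (1 + τ) / 2 + (m : ℂ) + (n : ℂ) * τ ↔
        τ * ((1 + 2 * (n : ℝ) : ℝ) : ℂ) = ((-2 * (m : ℝ) : ℝ) : ℂ) := by
      push_cast
      constructor
      · intro h; linear_combination -2 * h
      · intro h; linear_combination -h / 2
    have h4 := congrArg Complex.im (e.mp h)
    rwa [Complex.im_mul_ofReal, Complex.ofReal_im] at h4
  rcases mul_eq_zero.mp h3 with h4 | h4
  · linarith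
  · have h5 : (1 + 2 * n : ℤ) = 0 := by exact_mod_cast h4
    omega
end

section
/- For φ with 2π/3 < φ < π there exists a unique κ ∈ ℂ with Re κ > 0, Im κ < 0, and Re(1 + κ²) > 0 satisfying the Boutroux system: Re[ P·(−2κ²·K(κ') + (1 + κ²)·E(κ')) ] = 0 and Im[ P·((κ² − 1)·K(κ) + (1 + κ²)·E(κ)) ] = 0, where P = exp((3/2)·(i·φ − Log(1 + κ²))) with Log the principal complex logarithm, κ' = √(1 − κ²) with the principal complex square root, and for a complex modulus k the complete elliptic integrals are K(k) = ∫₀¹ ((1 − t²)(1 − k²t²))^{−1/2} dt and E(k) = ∫₀¹ ((1 − k²t²)/(1 − t²))^{1/2} dt, the square roots being principal. -/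
open Complex

/-- The complete elliptic integral of the first kind with complex modulus `k`,
with principal branches of the square roots. -/
noncomputable def ellipticK (k : ℂ) : ℂ :=
  ∫ t in (0:ℝ)..1, (((1 - (t : ℂ) ^ 2) * (1 - k ^ 2 * (t : ℂ) ^ 2)) ^ ((1 : ℂ) / 2))⁻¹

/-- The complete elliptic integral of the second kind with complex modulus `k`,
with principal branch of the square root. -/
noncomputable def ellipticE (k : ℂ) : ℂ :=
  ∫ t in (0:ℝ)..1, ((1 - k ^ 2 * (t : ℂ) ^ 2) / (1 - (t : ℂ) ^ 2)) ^ ((1 : ℂ) / 2)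

section

open Set MeasureTheory

noncomputable def rt (z : ℂ) : ℂ := z ^ ((1 : ℂ) / 2)

lemma rt_sq (z : ℂ) : rt z ^ 2 = z := by
  have := Complex.cpow_nat_inv_pow z (n := 2) two_ne_zero
  simpa [rt] using this

lemma rt_sq' (z : ℂ) : rt z * rt z = z := by rw [← sq, rt_sq]

lemma rt_zero : rt 0 = 0 := by simp [rt]

lemma rt_ne_zero {z : ℂ} (h : z ≠ 0) : rt z ≠ 0 := by
  intro h0
  have := rt_sq z
  rw [h0] at this
  exact h (by simpa using this.symm)

lemma rt_re_nonneg (z : ℂ) : 0 ≤ (rt z).re := by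
  by_cases h : z = 0
  · simp [h, rt_zero]
  · have e : rt z = exp (log z / 2) := by
      rw [rt, Complex.cpow_def_of_ne_zero h]; congr 1; ring
    rw [e, Complex.exp_re]
    apply mul_nonneg (Real.exp_pos _).le
    have e2 : (log z / 2).im = arg z / 2 := by
      have : (log z / 2) = ((1/2 : ℝ) : ℂ) * log z := by push_cast; ring
      rw [this, Complex.re_ofReal_mul |> fun _ => Complex.im_ofReal_mul, Complex.log_im]; ring
    rw [e2]
    apply Real.cos_nonneg_of_neg_pi_div_two_le_of_le <;>
      linarith [Complex.neg_pi_lt_arg z, Complex.arg_le_pi z]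

lemma rt_re_im (z : ℂ) : (rt z).re ^ 2 - (rt z).im ^ 2 = z.re ∧ 2 * (rt z).re * (rt z).im = z.im := by
  have h := rt_sq' z
  have h1 := congrArg Complex.re h
  have h2 := congrArg Complex.im h
  simp only [Complex.mul_re, Complex.mul_im] at h1 h2
  constructor <;> nlinarith

lemma rt_re_pos {z : ℂ} (h : z ∈ slitPlane) : 0 < (rt z).re := by
  rcases (rt_re_nonneg z).lt_or_eq with h0 | h0
  · exact h0
  · exfalso
    obtain ⟨h1, h2⟩ := rt_re_im z
    rw [← h0] at h1 h2
    rw [Complex.mem_slitPlane_iff] at h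
    rcases h with h | h
    · nlinarith [sq_nonneg (rt z).im]
    · apply h; rw [← h2]; ring

lemma rt_unique {x z : ℂ} (h : x ^ 2 = z) (hx : 0 < x.re) : rt z = x := by
  have h1 : rt z ^ 2 = x ^ 2 := by rw [rt_sq, h]
  rcases sq_eq_sq_iff_eq_or_eq_neg.mp h1 with h2 | h2
  · exact h2
  · exfalso
    have := rt_re_nonneg z
    rw [h2] at this
    simp at this; linarith

lemma hasDerivAt_rt {z : ℂ} (h : z ∈ slitPlane) : HasDerivAt rt (1 / (2 * rt z)) z := by
  have hz : z ≠ 0 := Complex.slitPlane_ne_zero h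
  have h1 := (hasDerivAt_id z).cpow_const (c := (1:ℂ)/2) (by simpa using h)
  have e : (1 / (2 * rt z)) = (1 / 2 : ℂ) * id z ^ ((1:ℂ) / 2 - 1) * 1 := by
    rw [id, Complex.cpow_sub _ _ hz, Complex.cpow_one]
    change _ = 1 / 2 * (rt z / z) * 1
    have := rt_ne_zero hz
    nth_rewrite 3 [← rt_sq' z]
    field_simp
  rw [e]; exact h1

lemma continuous_rt_at {z : ℂ} (h : 0 ≤ z.re ∨ z.im ≠ 0) : ContinuousAt rt z := 
  Complex.continuousAt_cpow_const_of_re_pos h (by norm_num)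

lemma rt_im_pos {z : ℂ} (h : 0 < z.im) : 0 < (rt z).im := by
  have hp := rt_re_pos (z := z) (Complex.mem_slitPlane_iff.2 (Or.inr h.ne'))
  have := (rt_re_im z).2
  by_contra hn
  push Not at hn
  nlinarith [mul_nonneg hp.le (neg_nonneg.2 hn)]

lemma rt_im_nonneg {z : ℂ} (hz : z ∈ slitPlane) (h : 0 ≤ z.im) : 0 ≤ (rt z).im := by
  have hp := rt_re_pos hz
  have := (rt_re_im z).2
  by_contra hn
  push Not at hn
  nlinarith [mul_pos hp (neg_pos.2 hn)]

lemma rt_im_nonpos {z : ℂ} (hz : z ∈ slitPlane) (h : z.im ≤ 0) : (rt z).im ≤ 0 := by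
  have hp := rt_re_pos hz
  have := (rt_re_im z).2
  by_contra hn
  push Not at hn
  nlinarith [mul_pos hp hn]

lemma rt_cone {z : ℂ} (h : 0 < z.re) : |(rt z).im| < (rt z).re := by
  have hp := rt_re_pos (z := z) (Complex.mem_slitPlane_iff.2 (Or.inl h))
  have := (rt_re_im z).1
  exact abs_lt_of_sq_lt_sq (by linarith) hp.le

lemma inv_re_pos {a : ℂ} (h : 0 < a.re) : 0 < (a⁻¹).re := by
  rw [Complex.inv_re]
  apply div_pos h
  rw [Complex.normSq_pos]; rintro rfl; simp at h

lemma inv_cone {a : ℂ} (h : |a.im| < a.re) : |(a⁻¹).im| < (a⁻¹).re := by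
  have h0 : 0 < a.re := lt_of_le_of_lt (abs_nonneg _) h
  have : 0 < Complex.normSq a := by
    rw [Complex.normSq_pos]; rintro rfl; simp at h0
  rw [Complex.inv_re, Complex.inv_im, abs_div, abs_neg, abs_of_pos this]
  exact div_lt_div_of_pos_right h this

noncomputable def Wf (ν : ℂ) (θ : ℝ) : ℂ := 1 / 2 + ν * ((Real.cos (2 * θ) : ℝ) : ℂ)
noncomputable def Vf (ν : ℂ) (θ : ℝ) : ℂ :=
  ((Real.cos θ ^ 2 / 2 : ℝ) : ℂ) + ν * ((1 + Real.sin θ ^ 2 : ℝ) : ℂ)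

noncomputable def Ft (ν : ℂ) : ℂ :=
  ∫ θ in (0:ℝ)..(Real.pi / 2), ((Real.sin (2 * θ) ^ 2 : ℝ) : ℂ) * (rt (Wf ν θ))⁻¹
noncomputable def Gt (ν : ℂ) : ℂ :=
  ∫ θ in (0:ℝ)..(Real.pi / 2), ((Real.cos θ ^ 2 : ℝ) : ℂ) * rt (Vf ν θ)
noncomputable def kW (ν : ℂ) : ℂ := ∫ θ in (0:ℝ)..(Real.pi / 2), (rt (Wf ν θ))⁻¹
noncomputable def kV (ν : ℂ) : ℂ := ∫ θ in (0:ℝ)..(Real.pi / 2), (rt (Vf ν θ))⁻¹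
noncomputable def Ff (ν : ℂ) : ℂ := 3 * ν ^ 2 * Ft ν
noncomputable def Gf (ν : ℂ) : ℂ := 3 * (1 / 2 - ν) * Gt ν

lemma Wf_re (ν : ℂ) (θ : ℝ) : (Wf ν θ).re = 1 / 2 + ν.re * Real.cos (2 * θ) := by
  simp [Wf, -ofReal_cos]
lemma Wf_im (ν : ℂ) (θ : ℝ) : (Wf ν θ).im = ν.im * Real.cos (2 * θ) := by
  simp [Wf, -ofReal_cos]
lemma Vf_re (ν : ℂ) (θ : ℝ) : (Vf ν θ).re = Real.cos θ ^ 2 / 2 + ν.re * (1 + Real.sin θ ^ 2) := by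
  simp only [Vf, add_re, mul_re, ofReal_re, ofReal_im]; ring
lemma Vf_im (ν : ℂ) (θ : ℝ) : (Vf ν θ).im = ν.im * (1 + Real.sin θ ^ 2) := by
  simp only [Vf, add_im, mul_im, ofReal_re, ofReal_im]; ring

lemma Wf_slit {ν : ℂ} (h : 0 < ν.im) (θ : ℝ) : Wf ν θ ∈ slitPlane := by
  rw [mem_slitPlane_iff, Wf_re, Wf_im]
  by_cases hc : Real.cos (2 * θ) = 0
  · left; rw [hc]; norm_num
  · right; exact mul_ne_zero h.ne' hc

lemma Vf_im_pos {ν : ℂ} (h : 0 < ν.im) (θ : ℝ) : 0 < (Vf ν θ).im := by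
  rw [Vf_im]; positivity

lemma Vf_slit {ν : ℂ} (h : 0 < ν.im) (θ : ℝ) : Vf ν θ ∈ slitPlane :=
  mem_slitPlane_iff.2 (Or.inr (Vf_im_pos h θ).ne')

lemma continuous_Wf : Continuous (fun p : ℂ × ℝ => Wf p.1 p.2) := by
  unfold Wf; fun_prop
lemma continuous_Vf : Continuous (fun p : ℂ × ℝ => Vf p.1 p.2) := by
  unfold Vf; fun_prop

lemma continuousOn_rt : ContinuousOn rt slitPlane := fun z hz =>
  (hasDerivAt_rt hz).continuousAt.continuousWithinAt

lemma contOn_rtW : ContinuousOn (fun p : ℂ × ℝ => rt (Wf p.1 p.2)) ({z : ℂ | 0 < z.im} ×ˢ univ) :=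
  continuousOn_rt.comp continuous_Wf.continuousOn (fun p hp => Wf_slit hp.1 _)
lemma contOn_rtV : ContinuousOn (fun p : ℂ × ℝ => rt (Vf p.1 p.2)) ({z : ℂ | 0 < z.im} ×ˢ univ) :=
  continuousOn_rt.comp continuous_Vf.continuousOn (fun p hp => Vf_slit hp.1 _)

lemma rtW_ne {ν : ℂ} (h : 0 < ν.im) (θ : ℝ) : rt (Wf ν θ) ≠ 0 :=
  rt_ne_zero (slitPlane_ne_zero (Wf_slit h θ))
lemma rtV_ne {ν : ℂ} (h : 0 < ν.im) (θ : ℝ) : rt (Vf ν θ) ≠ 0 :=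
  rt_ne_zero (slitPlane_ne_zero (Vf_slit h θ))

lemma contOn_rtW_inv :
    ContinuousOn (fun p : ℂ × ℝ => (rt (Wf p.1 p.2))⁻¹) ({z : ℂ | 0 < z.im} ×ˢ univ) :=
  contOn_rtW.inv₀ (fun p hp => rtW_ne hp.1 _)
lemma contOn_rtV_inv :
    ContinuousOn (fun p : ℂ × ℝ => (rt (Vf p.1 p.2))⁻¹) ({z : ℂ | 0 < z.im} ×ˢ univ) :=
  contOn_rtV.inv₀ (fun p hp => rtV_ne hp.1 _)

lemma slice_cont {f : ℂ → ℝ → ℂ}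
    (hf : ContinuousOn (fun p : ℂ × ℝ => f p.1 p.2) ({z : ℂ | 0 < z.im} ×ˢ univ))
    {ν : ℂ} (h : 0 < ν.im) : Continuous (f ν) := by
  rw [← continuousOn_univ]
  exact hf.comp (f := fun t : ℝ => (ν, t)) (by fun_prop) (fun t _ => ⟨h, mem_univ _⟩)

lemma cont_rtW_inv {ν : ℂ} (h : 0 < ν.im) : Continuous (fun θ => (rt (Wf ν θ))⁻¹) :=
  slice_cont (f := fun ν θ => (rt (Wf ν θ))⁻¹) contOn_rtW_inv h
lemma cont_rtV_inv {ν : ℂ} (h : 0 < ν.im) : Continuous (fun θ => (rt (Vf ν θ))⁻¹) :=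
  slice_cont (f := fun ν θ => (rt (Vf ν θ))⁻¹) contOn_rtV_inv h
lemma cont_rtV {ν : ℂ} (h : 0 < ν.im) : Continuous (fun θ => rt (Vf ν θ)) :=
  slice_cont (f := fun ν θ => rt (Vf ν θ)) contOn_rtV h

/-- differentiation under the integral sign -/
lemma param_deriv {F F' : ℂ → ℝ → ℂ} {a b : ℝ}
    (hF : ContinuousOn (fun p : ℂ × ℝ => F p.1 p.2) ({z : ℂ | 0 < z.im} ×ˢ univ))
    (hF' : ContinuousOn (fun p : ℂ × ℝ => F' p.1 p.2) ({z : ℂ | 0 < z.im} ×ˢ univ))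
    (hd : ∀ ν : ℂ, 0 < ν.im → ∀ θ, HasDerivAt (fun x => F x θ) (F' ν θ) ν)
    {ν : ℂ} (h : 0 < ν.im) :
    HasDerivAt (fun x => ∫ θ in a..b, F x θ) (∫ θ in a..b, F' ν θ) ν := by
  have hopen : IsOpen {z : ℂ | 0 < z.im} := isOpen_lt continuous_const continuous_im
  obtain ⟨ε, hε, hball⟩ := Metric.nhds_basis_closedBall.mem_iff.1 (hopen.mem_nhds h)
  have hcomp : IsCompact (Metric.closedBall ν ε ×ˢ uIcc a b) :=
    (isCompact_closedBall ν ε).prod isCompact_uIcc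
  obtain ⟨C, hC⟩ := hcomp.exists_bound_of_continuousOn
    (hF'.mono (prod_mono hball (subset_univ _)))
  refine (intervalIntegral.hasDerivAt_integral_of_dominated_loc_of_deriv_le
    (bound := fun _ => C) (F' := F') (Metric.closedBall_mem_nhds ν hε) ?_ ?_ ?_ ?_ ?_ ?_).2
  · filter_upwards [hopen.mem_nhds h] with x hx
    exact (slice_cont hF hx).aestronglyMeasurable
  · exact (slice_cont hF h).intervalIntegrable _ _
  · exact (slice_cont hF' h).aestronglyMeasurable
  · exact Filter.Eventually.of_forall fun t ht x hx => hC (x, t) ⟨hx, uIoc_subset_uIcc ht⟩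
  · exact intervalIntegrable_const
  · exact Filter.Eventually.of_forall fun t ht x hx => hd x (hball hx) t

lemma hasDerivAt_Wf (ν : ℂ) (θ : ℝ) :
    HasDerivAt (fun x => Wf x θ) ((Real.cos (2 * θ) : ℝ) : ℂ) ν := by
  unfold Wf
  simpa using ((hasDerivAt_id ν).mul_const ((Real.cos (2 * θ) : ℝ) : ℂ)).const_add (1 / 2)
lemma hasDerivAt_Vf (ν : ℂ) (θ : ℝ) :
    HasDerivAt (fun x => Vf x θ) ((1 + Real.sin θ ^ 2 : ℝ) : ℂ) ν := by
  unfold Vf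
  have := ((hasDerivAt_id ν).mul_const ((1 + Real.sin θ ^ 2 : ℝ) : ℂ)).const_add
    ((Real.cos θ ^ 2 / 2 : ℝ) : ℂ)
  rw [one_mul] at this
  exact this

lemma hasDerivAt_cos2 (θ : ℝ) : HasDerivAt (fun t : ℝ => ((Real.cos (2 * t) : ℝ) : ℂ))
    ((-2 * Real.sin (2 * θ) : ℝ) : ℂ) θ := by
  apply HasDerivAt.ofReal_comp
  have := (Real.hasDerivAt_cos (2 * θ)).comp θ ((hasDerivAt_id θ).const_mul 2)
  exact this.congr_deriv (by ring)
lemma hasDerivAt_sin2 (θ : ℝ) : HasDerivAt (fun t : ℝ => ((Real.sin (2 * t) : ℝ) : ℂ))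
    ((2 * Real.cos (2 * θ) : ℝ) : ℂ) θ := by
  apply HasDerivAt.ofReal_comp
  have := (Real.hasDerivAt_sin (2 * θ)).comp θ ((hasDerivAt_id θ).const_mul 2)
  exact this.congr_deriv (by ring)
lemma hasDerivAt_Wf' (ν : ℂ) (θ : ℝ) :
    HasDerivAt (fun t => Wf ν t) (ν * ((-2 * Real.sin (2 * θ) : ℝ) : ℂ)) θ :=
  ((hasDerivAt_cos2 θ).const_mul ν).const_add (1 / 2)
lemma hasDerivAt_Vf' (ν : ℂ) (θ : ℝ) :
    HasDerivAt (fun t => Vf ν t) ((2 * ν - 1) * ((Real.sin θ * Real.cos θ : ℝ) : ℂ)) θ := by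
  have h1 : HasDerivAt (fun t : ℝ => Real.cos t ^ 2 / 2) (- (Real.sin θ * Real.cos θ)) θ := by
    have := ((Real.hasDerivAt_cos θ).pow 2).div_const 2
    exact this.congr_deriv (by simp; ring)
  have h2 : HasDerivAt (fun t : ℝ => 1 + Real.sin t ^ 2) (2 * (Real.sin θ * Real.cos θ)) θ := by
    have := ((Real.hasDerivAt_sin θ).pow 2).const_add 1
    exact this.congr_deriv (by simp; ring)
  have := h1.ofReal_comp.add (h2.ofReal_comp.const_mul ν)
  exact this.congr_deriv (by push_cast; ring)

lemma sc2 (θ : ℝ) : ((Real.sin (2 * θ) : ℝ) : ℂ) ^ 2 = 1 - ((Real.cos (2 * θ) : ℝ) : ℂ) ^ 2 := by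
  have := Real.sin_sq_add_cos_sq (2 * θ)
  have h : Real.sin (2 * θ) ^ 2 = 1 - Real.cos (2 * θ) ^ 2 := by linarith
  exact_mod_cast congrArg ((↑) : ℝ → ℂ) h
lemma sc1 (θ : ℝ) : ((Real.cos θ : ℝ) : ℂ) ^ 2 = 1 - ((Real.sin θ : ℝ) : ℂ) ^ 2 := by
  have := Real.sin_sq_add_cos_sq θ
  have h : Real.cos θ ^ 2 = 1 - Real.sin θ ^ 2 := by linarith
  exact_mod_cast congrArg ((↑) : ℝ → ℂ) h

lemma hasDerivAt_Ff {ν : ℂ} (h : 0 < ν.im) : HasDerivAt Ff (3 * ν * kW ν) ν := by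
  -- derivative of the inner integral
  have h1 : HasDerivAt Ft (∫ θ in (0:ℝ)..(Real.pi / 2), ((Real.sin (2 * θ) ^ 2 : ℝ) : ℂ) *
      (-(1 / (2 * rt (Wf ν θ)) * ((Real.cos (2 * θ) : ℝ) : ℂ)) / rt (Wf ν θ) ^ 2)) ν := by
    refine param_deriv (F := fun ν θ => ((Real.sin (2 * θ) ^ 2 : ℝ) : ℂ) * (rt (Wf ν θ))⁻¹)
      (F' := fun ν θ => ((Real.sin (2 * θ) ^ 2 : ℝ) : ℂ) *
      (-(1 / (2 * rt (Wf ν θ)) * ((Real.cos (2 * θ) : ℝ) : ℂ)) / rt (Wf ν θ) ^ 2)) ?_ ?_ ?_ h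
    · exact ContinuousOn.mul (by fun_prop) contOn_rtW_inv
    · have := contOn_rtW
      refine ContinuousOn.mul (by fun_prop) (ContinuousOn.div (ContinuousOn.neg (ContinuousOn.mul
        (ContinuousOn.div (by fun_prop) (this.const_mul 2 |>.congr fun _ _ => rfl) ?_) (by fun_prop))) (this.pow 2) ?_)
      · intro p hp; exact mul_ne_zero two_ne_zero (rtW_ne hp.1 _)
      · intro p hp; exact pow_ne_zero 2 (rtW_ne hp.1 _)
    · intro ν hν θ
      have h0 := (hasDerivAt_rt (Wf_slit hν θ)).comp ν (hasDerivAt_Wf ν θ)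
      have := h0.inv (rtW_ne hν θ)
      exact this.const_mul _
  have h2 : HasDerivAt Ff (6 * ν * Ft ν + 3 * ν ^ 2 * (∫ θ in (0:ℝ)..(Real.pi / 2), ((Real.sin (2 * θ) ^ 2 : ℝ) : ℂ) *
      (-(1 / (2 * rt (Wf ν θ)) * ((Real.cos (2 * θ) : ℝ) : ℂ)) / rt (Wf ν θ) ^ 2))) ν := by
    have := (((hasDerivAt_id ν).pow 2).const_mul 3).mul h1
    refine this.congr_deriv ?_
    simp only [id, Pi.pow_apply]
    push_cast; ring
  have hI : IntervalIntegrable (fun θ : ℝ => ((Real.sin (2 * θ) ^ 2 : ℝ) : ℂ) *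
      (-(1 / (2 * rt (Wf ν θ)) * ((Real.cos (2 * θ) : ℝ) : ℂ)) / rt (Wf ν θ) ^ 2)) volume 0 (Real.pi / 2) := by
    apply Continuous.intervalIntegrable
    have e : (fun θ : ℝ => ((Real.sin (2 * θ) ^ 2 : ℝ) : ℂ) *
      (-(1 / (2 * rt (Wf ν θ)) * ((Real.cos (2 * θ) : ℝ) : ℂ)) / rt (Wf ν θ) ^ 2)) =
      (fun θ : ℝ => ((Real.sin (2 * θ) ^ 2 : ℝ) : ℂ) *
      (-(1 / 2) * ((Real.cos (2 * θ) : ℝ) : ℂ)) * ((rt (Wf ν θ))⁻¹) ^ 3) := by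
      ext θ; have := rtW_ne h θ; field_simp
    rw [e]
    exact Continuous.mul (by fun_prop) ((cont_rtW_inv h).pow 3)
  have hI2 : IntervalIntegrable (fun θ : ℝ => ((Real.sin (2 * θ) ^ 2 : ℝ) : ℂ) * (rt (Wf ν θ))⁻¹) volume 0 (Real.pi / 2) :=
    (Continuous.mul (by fun_prop) (cont_rtW_inv h)).intervalIntegrable _ _
  have hI3 : IntervalIntegrable (fun θ : ℝ => (rt (Wf ν θ))⁻¹) volume 0 (Real.pi / 2) :=
    (cont_rtW_inv h).intervalIntegrable _ _
  have key : (∫ θ in (0:ℝ)..(Real.pi / 2), ((6 * ν * (((Real.sin (2 * θ) ^ 2 : ℝ) : ℂ) * (rt (Wf ν θ))⁻¹) +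
      3 * ν ^ 2 * (((Real.sin (2 * θ) ^ 2 : ℝ) : ℂ) *
      (-(1 / (2 * rt (Wf ν θ)) * ((Real.cos (2 * θ) : ℝ) : ℂ)) / rt (Wf ν θ) ^ 2))) - 3 * ν * (rt (Wf ν θ))⁻¹)) = 0 := by
    rw [intervalIntegral.integral_eq_sub_of_hasDerivAt
      (f := fun θ : ℝ => -(3 / 2) * ν * (((Real.sin (2 * θ) : ℝ) : ℂ) * ((Real.cos (2 * θ) : ℝ) : ℂ)) * (rt (Wf ν θ))⁻¹)]
    · have : Real.sin (2 * (Real.pi / 2)) = 0 := by rw [mul_div_cancel₀ _ two_ne_zero]; exact Real.sin_pi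
      rw [this]; simp
    · intro θ _
      have hr := rtW_ne h θ
      have h0 := (hasDerivAt_rt (Wf_slit h θ)).comp θ (hasDerivAt_Wf' ν θ)
      have h3 := h0.inv hr
      have h4 := (((hasDerivAt_sin2 θ).mul (hasDerivAt_cos2 θ)).const_mul (-(3 / 2) * ν)).mul h3
      refine h4.congr_deriv ?_
      have hs := sc2 θ
      have hW : rt (Wf ν θ) ^ 2 = 1 / 2 + ν * ((Real.cos (2 * θ) : ℝ) : ℂ) := rt_sq _
      simp only [Function.comp, Pi.mul_apply, Pi.inv_apply]
      push_cast [-ofReal_cos, -ofReal_sin] at *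
      generalize ((Real.sin (2 * θ) : ℝ) : ℂ) = S at *
      generalize ((Real.cos (2 * θ) : ℝ) : ℂ) = C at *
      generalize rt (Wf ν θ) = R at *
      field_simp
      rw [hs, hW]
      ring_nf
    · exact (((hI2.const_mul _).add (hI.const_mul _)).sub (hI3.const_mul _))
  refine h2.congr_deriv ?_
  rw [intervalIntegral.integral_sub ((hI2.const_mul _).add (hI.const_mul _)) (hI3.const_mul _),
    intervalIntegral.integral_add (hI2.const_mul _) (hI.const_mul _),
    intervalIntegral.integral_const_mul, intervalIntegral.integral_const_mul,
    intervalIntegral.integral_const_mul] at key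
  exact sub_eq_zero.1 key

lemma hasDerivAt_Gf {ν : ℂ} (h : 0 < ν.im) : HasDerivAt Gf (-3 * ν * kV ν) ν := by
  have h1 : HasDerivAt Gt (∫ θ in (0:ℝ)..(Real.pi / 2), ((Real.cos θ ^ 2 : ℝ) : ℂ) *
      (1 / (2 * rt (Vf ν θ)) * ((1 + Real.sin θ ^ 2 : ℝ) : ℂ))) ν := by
    refine param_deriv (F := fun ν θ => ((Real.cos θ ^ 2 : ℝ) : ℂ) * rt (Vf ν θ))
      (F' := fun ν θ => ((Real.cos θ ^ 2 : ℝ) : ℂ) *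
      (1 / (2 * rt (Vf ν θ)) * ((1 + Real.sin θ ^ 2 : ℝ) : ℂ))) ?_ ?_ ?_ h
    · exact ContinuousOn.mul (by fun_prop) contOn_rtV
    · have := contOn_rtV
      refine ContinuousOn.mul (by fun_prop) (ContinuousOn.mul
        (ContinuousOn.div (by fun_prop) (this.const_mul 2 |>.congr fun _ _ => rfl) ?_) (by fun_prop))
      · intro p hp; exact mul_ne_zero two_ne_zero (rtV_ne hp.1 _)
    · intro ν hν θ
      have := ((hasDerivAt_rt (Vf_slit hν θ)).comp ν (hasDerivAt_Vf ν θ))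
      exact this.const_mul _
  have h2 : HasDerivAt Gf (-3 * Gt ν + 3 * (1 / 2 - ν) * (∫ θ in (0:ℝ)..(Real.pi / 2), ((Real.cos θ ^ 2 : ℝ) : ℂ) *
      (1 / (2 * rt (Vf ν θ)) * ((1 + Real.sin θ ^ 2 : ℝ) : ℂ)))) ν := by
    have := (((hasDerivAt_id ν).const_sub (1 / 2)).const_mul 3).mul h1
    exact this.congr_deriv (by simp)
  have hI : IntervalIntegrable (fun θ : ℝ => ((Real.cos θ ^ 2 : ℝ) : ℂ) *
      (1 / (2 * rt (Vf ν θ)) * ((1 + Real.sin θ ^ 2 : ℝ) : ℂ))) volume 0 (Real.pi / 2) := by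
    apply Continuous.intervalIntegrable
    have e : (fun θ : ℝ => ((Real.cos θ ^ 2 : ℝ) : ℂ) *
      (1 / (2 * rt (Vf ν θ)) * ((1 + Real.sin θ ^ 2 : ℝ) : ℂ))) =
      (fun θ : ℝ => ((Real.cos θ ^ 2 : ℝ) : ℂ) * (1 / 2) *
      ((1 + Real.sin θ ^ 2 : ℝ) : ℂ) * (rt (Vf ν θ))⁻¹) := by
      ext θ; have := rtV_ne h θ; field_simp
    rw [e]
    exact Continuous.mul (by fun_prop) (cont_rtV_inv h)
  have hI2 : IntervalIntegrable (fun θ : ℝ => ((Real.cos θ ^ 2 : ℝ) : ℂ) * rt (Vf ν θ)) volume 0 (Real.pi / 2) :=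
    (Continuous.mul (by fun_prop) (cont_rtV h)).intervalIntegrable _ _
  have hI3 : IntervalIntegrable (fun θ : ℝ => (rt (Vf ν θ))⁻¹) volume 0 (Real.pi / 2) :=
    (cont_rtV_inv h).intervalIntegrable _ _
  have key : (∫ θ in (0:ℝ)..(Real.pi / 2), ((-3 * (((Real.cos θ ^ 2 : ℝ) : ℂ) * rt (Vf ν θ)) +
      3 * (1 / 2 - ν) * (((Real.cos θ ^ 2 : ℝ) : ℂ) *
      (1 / (2 * rt (Vf ν θ)) * ((1 + Real.sin θ ^ 2 : ℝ) : ℂ)))) - -3 * ν * (rt (Vf ν θ))⁻¹)) = 0 := by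
    rw [intervalIntegral.integral_eq_sub_of_hasDerivAt
      (f := fun θ : ℝ => -(3 / 2) * (((Real.sin θ : ℝ) : ℂ) * ((Real.cos θ : ℝ) : ℂ)) * rt (Vf ν θ))]
    · rw [Real.cos_pi_div_two, Real.sin_zero]; simp
    · intro θ _
      have hr := rtV_ne h θ
      have h3 := ((hasDerivAt_rt (Vf_slit h θ)).comp θ (hasDerivAt_Vf' ν θ))
      have h4 := ((((Real.hasDerivAt_sin θ).ofReal_comp).mul ((Real.hasDerivAt_cos θ).ofReal_comp)).const_mul (-(3 / 2))).mul h3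
      refine h4.congr_deriv ?_
      have hs := sc1 θ
      have hW : rt (Vf ν θ) ^ 2 = ((Real.cos θ ^ 2 / 2 : ℝ) : ℂ) + ν * ((1 + Real.sin θ ^ 2 : ℝ) : ℂ) :=
        rt_sq _
      simp only [Function.comp, Pi.mul_apply, Pi.inv_apply]
      push_cast [-ofReal_cos, -ofReal_sin] at *
      generalize ((Real.sin θ : ℝ) : ℂ) = S at *
      generalize ((Real.cos θ : ℝ) : ℂ) = C at *
      generalize rt (Vf ν θ) = R at *
      field_simp
      rw [hW, hs]
      ring_nf
    · exact (((hI2.const_mul _).add (hI.const_mul _)).sub (hI3.const_mul _))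
  refine h2.congr_deriv ?_
  rw [intervalIntegral.integral_sub ((hI2.const_mul _).add (hI.const_mul _)) (hI3.const_mul _),
    intervalIntegral.integral_add (hI2.const_mul _) (hI.const_mul _),
    intervalIntegral.integral_const_mul, intervalIntegral.integral_const_mul,
    intervalIntegral.integral_const_mul] at key
  exact sub_eq_zero.1 key

lemma int_re_eq {g : ℝ → ℂ} {a b : ℝ} (u : ℂ) (hg : IntervalIntegrable g volume a b) :
    (u * ∫ θ in a..b, g θ).re = ∫ θ in a..b, (u * g θ).re := by
  rw [← intervalIntegral.integral_const_mul]
  exact (Complex.reCLM.intervalIntegral_comp_comm (hg.const_mul u)).symm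

lemma int_re_integrable {g : ℝ → ℂ} {a b : ℝ} (u : ℂ) (hg : IntervalIntegrable g volume a b) :
    IntervalIntegrable (fun θ => (u * g θ).re) volume a b := by
  have h := hg.const_mul u
  exact ⟨h.1.re, h.2.re⟩

lemma int_re_pos {g : ℝ → ℂ} {a b : ℝ} (hab : a < b) (u : ℂ)
    (hg : IntervalIntegrable g volume a b) (h : ∀ θ ∈ Ioo a b, 0 < (u * g θ).re) :
    0 < (u * ∫ θ in a..b, g θ).re := by
  rw [int_re_eq u hg]
  exact intervalIntegral.intervalIntegral_pos_of_pos_on (int_re_integrable u hg) h hab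

lemma int_re_nonneg {g : ℝ → ℂ} {a b : ℝ} (hab : a ≤ b) (u : ℂ)
    (hg : IntervalIntegrable g volume a b) (h : ∀ θ ∈ Icc a b, 0 ≤ (u * g θ).re) :
    0 ≤ (u * ∫ θ in a..b, g θ).re := by
  rw [int_re_eq u hg]
  exact intervalIntegral.integral_nonneg hab h

lemma pi2_pos : (0:ℝ) < Real.pi / 2 := by positivity

lemma cone_int {g : ℝ → ℂ} {a b : ℝ} (hab : a < b)
    (hg : IntervalIntegrable g volume a b) (h : ∀ θ ∈ Ioo a b, |(g θ).im| < (g θ).re) :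
    |(∫ θ in a..b, g θ).im| < (∫ θ in a..b, g θ).re := by
  have h1 := int_re_pos hab (1 + I) hg (fun θ hθ => by
    have := abs_lt.1 (h θ hθ); simp [add_mul]; linarith [this.1, this.2])
  have h2 := int_re_pos hab (1 - I) hg (fun θ hθ => by
    have := abs_lt.1 (h θ hθ); simp [sub_mul]; linarith [this.1, this.2])
  simp [add_mul] at h1
  simp [sub_mul] at h2
  rw [abs_lt]; constructor <;> linarith

lemma cone_smul {r : ℝ} (hr : 0 < r) {z : ℂ} (h : |z.im| < z.re) :
    |((r : ℂ) * z).im| < ((r : ℂ) * z).re := by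
  rw [re_ofReal_mul, im_ofReal_mul, abs_mul, abs_of_pos hr]
  exact mul_lt_mul_of_pos_left h hr

lemma cone_mul_pos {a b : ℂ} (ha : |a.im| < a.re) (hb : |b.im| < b.re) :
    0 < ((starRingEnd ℂ) a * b).re := by
  simp only [mul_re, conj_re, conj_im]
  have h1 : |a.im * b.im| < a.re * b.re := by
    rw [abs_mul]
    exact mul_lt_mul'' ha hb (abs_nonneg _) (abs_nonneg _)
  have := (abs_lt.1 h1).1
  linarith

lemma abs_cos_le (θ : ℝ) : |Real.cos θ| ≤ 1 := Real.abs_cos_le_one θ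

lemma Wf_re_pos {ν : ℂ} (h : ‖ν‖ < 1 / 2) (θ : ℝ) : 0 < (Wf ν θ).re := by
  rw [Wf_re]
  have h1 : |ν.re * Real.cos (2 * θ)| ≤ ‖ν‖ := by
    rw [abs_mul]
    calc _ ≤ |ν.re| * 1 := mul_le_mul_of_nonneg_left (abs_cos_le _) (abs_nonneg _)
      _ ≤ ‖ν‖ := by rw [mul_one]; exact abs_re_le_norm ν
  have := (abs_le.1 h1).1
  linarith

lemma sin2_pos {θ : ℝ} (h : θ ∈ Ioo 0 (Real.pi / 2)) : 0 < Real.sin (2 * θ) :=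
  Real.sin_pos_of_pos_of_lt_pi (by linarith [h.1]) (by linarith [h.2])
lemma cos_pos' {θ : ℝ} (h : θ ∈ Ioo 0 (Real.pi / 2)) : 0 < Real.cos θ :=
  Real.cos_pos_of_mem_Ioo ⟨by linarith [h.1, pi2_pos], h.2⟩

lemma kW_cone {ν : ℂ} (h : 0 < ν.im) (h' : ‖ν‖ < 1 / 2) : |(kW ν).im| < (kW ν).re :=
  cone_int pi2_pos ((cont_rtW_inv h).intervalIntegrable _ _)
    (fun θ _ => inv_cone (rt_cone (Wf_re_pos h' θ)))

lemma Ft_integrable {ν : ℂ} (h : 0 < ν.im) : IntervalIntegrable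
    (fun θ : ℝ => ((Real.sin (2 * θ) ^ 2 : ℝ) : ℂ) * (rt (Wf ν θ))⁻¹) volume 0 (Real.pi / 2) :=
  (Continuous.mul (by fun_prop) (cont_rtW_inv h)).intervalIntegrable _ _

lemma Ft_cone {ν : ℂ} (h : 0 < ν.im) (h' : ‖ν‖ < 1 / 2) : |(Ft ν).im| < (Ft ν).re :=
  cone_int pi2_pos (Ft_integrable h)
    (fun θ hθ => cone_smul (pow_pos (sin2_pos hθ) 2) (inv_cone (rt_cone (Wf_re_pos h' θ))))

lemma kV_cone {ν : ℂ} (h : 0 < ν.im) (h' : 0 ≤ ν.re) : |(kV ν).im| < (kV ν).re :=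
  cone_int pi2_pos ((cont_rtV_inv h).intervalIntegrable _ _)
    (fun θ hθ => inv_cone (rt_cone (by
      rw [Vf_re]
      have := cos_pos' hθ
      positivity)))

lemma kV_re_pos {ν : ℂ} (h : 0 < ν.im) : 0 < (kV ν).re := by
  have := int_re_pos pi2_pos 1 ((cont_rtV_inv h).intervalIntegrable _ _)
    (fun θ hθ => by rw [one_mul]; exact inv_re_pos (rt_re_pos (Vf_slit h θ)))
  rwa [one_mul] at this

lemma inv_im_neg {a : ℂ} (h : 0 < a.im) : (a⁻¹).im < 0 := by
  rw [Complex.inv_im]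
  apply div_neg_of_neg_of_pos (by linarith)
  rw [Complex.normSq_pos]; rintro rfl; simp at h

lemma kV_im_neg {ν : ℂ} (h : 0 < ν.im) : (kV ν).im < 0 := by
  have := int_re_pos pi2_pos I ((cont_rtV_inv h).intervalIntegrable _ _)
    (fun θ hθ => by
      have := inv_im_neg (rt_im_pos (Vf_im_pos h θ))
      simp only [I_mul_re]; linarith)
  simp only [I_mul_re] at this
  change 0 < - (kV ν).im at this
  linarith

lemma Ft_re_pos {ν : ℂ} (h : 0 < ν.im) : 0 < (Ft ν).re := by
  have := int_re_pos pi2_pos 1 (Ft_integrable h)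
    (fun θ hθ => by
      rw [one_mul, re_ofReal_mul]
      exact mul_pos (pow_pos (sin2_pos hθ) 2) (inv_re_pos (rt_re_pos (Wf_slit h θ))))
  rwa [one_mul] at this

/-- the symmetrised integrand -/
lemma pair_sign {z : ℂ} (hp : 1 / 2 + z ∈ slitPlane) (hq : 1 / 2 - z ∈ slitPlane) :
    (0 ≤ z.re * z.im → 0 ≤ ((rt (1 / 2 + z))⁻¹ + (rt (1 / 2 - z))⁻¹).im) ∧
    (z.re * z.im ≤ 0 → ((rt (1 / 2 + z))⁻¹ + (rt (1 / 2 - z))⁻¹).im ≤ 0) := by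
  have hp2 := rt_sq' (1 / 2 + z)
  have hq2 := rt_sq' (1 / 2 - z)
  have hpr := rt_re_pos hp
  have hqr := rt_re_pos hq
  have hpi := (rt_re_im (1 / 2 + z)).2
  have hqi := (rt_re_im (1 / 2 - z)).2
  set p := rt (1 / 2 + z)
  set q := rt (1 / 2 - z)
  have hp0 : p ≠ 0 := by rintro h; rw [h] at hpr; simp at hpr
  have hq0 : q ≠ 0 := by rintro h; rw [h] at hqr; simp at hqr
  have hpq : p * p + q * q = 1 := by rw [hp2, hq2]; ring
  have him : p.im * q.im ≤ 0 := by
    have e : (1 / 2 + z).im = - (1 / 2 - z).im := by simp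
    rw [e] at hpi
    by_contra hc
    push Not at hc
    have h1 : 0 < (2 * p.re * p.im) * (2 * q.re * q.im) := by
      have : (2 * p.re * p.im) * (2 * q.re * q.im) = 4 * (p.re * q.re) * (p.im * q.im) := by ring
      rw [this]; positivity
    rw [hpi, hqi] at h1
    nlinarith [sq_nonneg ((1 / 2 - z).im)]
  have hre : 0 < (p * q).re := by
    rw [mul_re]; nlinarith [mul_pos hpr hqr]
  have hsq : (p * q) * (p * q) = 1 / 4 - z * z := by
    calc _ = (p * p) * (q * q) := by ring
      _ = _ := by rw [hp2, hq2]; ring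
  have hsqi : 2 * (p * q).re * (p * q).im = - (2 * (z.re * z.im)) := by
    have := congrArg Complex.im hsq
    rw [mul_im, sub_im, mul_im] at this
    norm_num at this ⊢
    nlinarith
  -- t = (p q)⁻¹
  have ht : (p⁻¹ + q⁻¹) * (p⁻¹ + q⁻¹) = (p * q)⁻¹ * (p * q)⁻¹ + 2 * (p * q)⁻¹ := by
    field_simp
    linear_combination hpq
  have htr : 0 < ((p * q)⁻¹).re := inv_re_pos hre
  have hS : 0 < (p⁻¹ + q⁻¹).re := by
    rw [add_re]; exact add_pos (inv_re_pos hpr) (inv_re_pos hqr)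
  have hti : (p⁻¹ + q⁻¹).re * (p⁻¹ + q⁻¹).im = (((p * q)⁻¹).re + 1) * ((p * q)⁻¹).im := by
    have := congrArg Complex.im ht
    rw [mul_im, add_im (_ * _), mul_im ((p * q)⁻¹), mul_im 2] at this
    norm_num at this ⊢
    nlinarith
  have hN : 0 < normSq (p * q) := by
    rw [Complex.normSq_pos]; exact mul_ne_zero hp0 hq0
  constructor
  · intro hz
    have h1 : (p * q).im ≤ 0 := by
      by_contra hc; push Not at hc; nlinarith [mul_pos hre hc]
    have h2 : 0 ≤ ((p * q)⁻¹).im := by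
      rw [inv_im]; exact div_nonneg (by linarith) hN.le
    by_contra hc; push Not at hc
    nlinarith [mul_pos hS (neg_pos.2 hc), mul_nonneg htr.le h2]
  · intro hz
    have h1 : 0 ≤ (p * q).im := by
      by_contra hc; push Not at hc; nlinarith [mul_pos hre (neg_pos.2 hc)]
    have h2 : ((p * q)⁻¹).im ≤ 0 := by
      rw [inv_im]; exact div_nonpos_of_nonpos_of_nonneg (by linarith) hN.le
    by_contra hc; push Not at hc
    nlinarith [mul_pos hS hc, mul_nonneg htr.le (neg_nonneg.2 h2)]

lemma Wf_refl (ν : ℂ) (θ : ℝ) : Wf ν (Real.pi / 2 - θ) = 1 / 2 - ν * ((Real.cos (2 * θ) : ℝ) : ℂ) := by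
  have : Real.cos (2 * (Real.pi / 2 - θ)) = - Real.cos (2 * θ) := by
    rw [← Real.cos_pi_sub]; congr 1; ring
  rw [Wf, this]; push_cast; ring

lemma Ft_pair {ν : ℂ} (h : 0 < ν.im) : 2 * Ft ν = ∫ θ in (0:ℝ)..(Real.pi / 2),
    ((Real.sin (2 * θ) ^ 2 : ℝ) : ℂ) * ((rt (Wf ν θ))⁻¹ + (rt (Wf ν (Real.pi / 2 - θ)))⁻¹) := by
  have hi := Ft_integrable h
  have e : Ft ν = ∫ θ in (0:ℝ)..(Real.pi / 2),
      ((Real.sin (2 * θ) ^ 2 : ℝ) : ℂ) * (rt (Wf ν (Real.pi / 2 - θ)))⁻¹ := by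
    have := intervalIntegral.integral_comp_sub_left (a := 0) (b := Real.pi / 2)
      (fun θ : ℝ => ((Real.sin (2 * θ) ^ 2 : ℝ) : ℂ) * (rt (Wf ν θ))⁻¹) (Real.pi / 2)
    rw [sub_zero, sub_self] at this
    rw [Ft, ← this]
    congr 1; ext θ
    have : Real.sin (2 * (Real.pi / 2 - θ)) = Real.sin (2 * θ) := by
      rw [← Real.sin_pi_sub]; congr 1; ring
    rw [this]
  have hi2 : IntervalIntegrable (fun θ : ℝ =>
      ((Real.sin (2 * θ) ^ 2 : ℝ) : ℂ) * (rt (Wf ν (Real.pi / 2 - θ)))⁻¹) volume 0 (Real.pi / 2) :=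
    (Continuous.mul (by fun_prop)
      ((cont_rtW_inv h).comp (continuous_const.sub continuous_id))).intervalIntegrable _ _
  rw [two_mul]
  nth_rewrite 2 [e]
  rw [Ft, ← intervalIntegral.integral_add hi hi2]
  congr 1; ext θ; ring

lemma Ft_pair_integrable {ν : ℂ} (h : 0 < ν.im) : IntervalIntegrable (fun θ : ℝ =>
    ((Real.sin (2 * θ) ^ 2 : ℝ) : ℂ) * ((rt (Wf ν θ))⁻¹ + (rt (Wf ν (Real.pi / 2 - θ)))⁻¹))
    volume 0 (Real.pi / 2) :=
  (Continuous.mul (by fun_prop) ((cont_rtW_inv h).add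
      ((cont_rtW_inv h).comp (continuous_const.sub continuous_id)))).intervalIntegrable _ _

lemma pair_sign' {ν : ℂ} (h : 0 < ν.im) (θ : ℝ) :
    (0 ≤ ν.re → 0 ≤ ((rt (Wf ν θ))⁻¹ + (rt (Wf ν (Real.pi / 2 - θ)))⁻¹).im) ∧
    (ν.re ≤ 0 → ((rt (Wf ν θ))⁻¹ + (rt (Wf ν (Real.pi / 2 - θ)))⁻¹).im ≤ 0) := by
  have hs := Wf_slit h θ
  have hs' := Wf_slit h (Real.pi / 2 - θ)
  rw [Wf_refl] at *
  rw [Wf] at *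
  have := pair_sign hs hs'
  have e : (ν * ((Real.cos (2 * θ) : ℝ) : ℂ)).re * (ν * ((Real.cos (2 * θ) : ℝ) : ℂ)).im =
      ν.re * (ν.im * Real.cos (2 * θ) ^ 2) := by
    simp only [mul_re, mul_im, ofReal_re, ofReal_im]; ring
  rw [e] at this
  exact ⟨fun hr => this.1 (by positivity), fun hr => this.2 (mul_nonpos_of_nonpos_of_nonneg hr (by positivity))⟩

lemma Ft_im_nonneg {ν : ℂ} (h : 0 < ν.im) (h' : 0 ≤ ν.re) : 0 ≤ (Ft ν).im := by
  have := int_re_nonneg pi2_pos.le (-I) (Ft_pair_integrable h) (fun θ _ => by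
    have := (pair_sign' h θ).1 h'
    rw [neg_mul, neg_re, I_mul_re, neg_neg, im_ofReal_mul]
    exact mul_nonneg (by positivity) this)
  rw [← Ft_pair h, neg_mul, neg_re, I_mul_re, neg_neg] at this
  simp at this; linarith

lemma Ft_im_nonpos {ν : ℂ} (h : 0 < ν.im) (h' : ν.re ≤ 0) : (Ft ν).im ≤ 0 := by
  have := int_re_nonneg pi2_pos.le I (Ft_pair_integrable h) (fun θ _ => by
    have := (pair_sign' h θ).2 h'
    rw [I_mul_re, im_ofReal_mul, ← mul_neg]
    exact mul_nonneg (by positivity) (neg_nonneg.2 this))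
  rw [← Ft_pair h, I_mul_re] at this
  simp at this; linarith

lemma norm_rt_sq (z : ℂ) : ‖rt z‖ ^ 2 = ‖z‖ := by
  rw [← norm_pow, rt_sq]

lemma norm_rt_le (z : ℂ) : ‖rt z‖ ≤ 1 + ‖z‖ := by
  have := norm_rt_sq z
  nlinarith [sq_nonneg (‖rt z‖ - 1), norm_nonneg (rt z)]

lemma measurable_rt : Measurable rt := by
  unfold rt; exact measurable_id.pow_const _

lemma Wf_meas (ν : ℂ) : Measurable (fun θ => Wf ν θ) := by unfold Wf; fun_prop
lemma Vf_meas (ν : ℂ) : Measurable (fun θ => Vf ν θ) := by unfold Vf; fun_prop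

lemma Vf_norm (ν : ℂ) (θ : ℝ) : ‖Vf ν θ‖ ≤ 1 / 2 + 2 * ‖ν‖ := by
  unfold Vf
  refine (norm_add_le _ _).trans ?_
  rw [norm_mul, norm_real, norm_real, Real.norm_eq_abs, Real.norm_eq_abs,
    abs_of_nonneg (by positivity), abs_of_nonneg (by positivity)]
  have := Real.sin_sq_add_cos_sq θ
  nlinarith [norm_nonneg ν, sq_nonneg (Real.sin θ), sq_nonneg (Real.cos θ)]

lemma Gt_bound (ν : ℂ) (θ : ℝ) :
    ‖((Real.cos θ ^ 2 : ℝ) : ℂ) * rt (Vf ν θ)‖ ≤ 3 / 2 + 2 * ‖ν‖ := by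
  rw [norm_mul, norm_real, Real.norm_eq_abs, abs_of_nonneg (by positivity)]
  have h1 := norm_rt_le (Vf ν θ)
  have h2 := Vf_norm ν θ
  have := Real.sin_sq_add_cos_sq θ
  nlinarith [norm_nonneg (rt (Vf ν θ)), sq_nonneg (Real.sin θ), sq_nonneg (Real.cos θ)]

lemma Gt_meas (ν : ℂ) :
    Measurable (fun θ : ℝ => ((Real.cos θ ^ 2 : ℝ) : ℂ) * rt (Vf ν θ)) := by
  have := measurable_rt.comp (Vf_meas ν)
  exact Measurable.mul (by fun_prop) this

lemma Gt_integrable (ν : ℂ) : IntervalIntegrable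
    (fun θ : ℝ => ((Real.cos θ ^ 2 : ℝ) : ℂ) * rt (Vf ν θ)) volume 0 (Real.pi / 2) := by
  refine IntervalIntegrable.mono_fun (f := fun _ : ℝ => (3 / 2 + 2 * ‖ν‖ : ℝ)) ?_ (Gt_meas ν).aestronglyMeasurable ?_
  · exact intervalIntegrable_const
  · refine Filter.Eventually.of_forall (fun θ => (Gt_bound ν θ).trans (le_abs_self _))

lemma Gt_cont {ν : ℂ} (h : 0 ≤ ν.re ∨ 0 < ν.im) : ContinuousAt Gt ν := by
  unfold Gt
  refine intervalIntegral.continuousAt_of_dominated_interval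
    (bound := fun _ => 3 / 2 + 2 * (‖ν‖ + 1)) ?_ ?_ intervalIntegrable_const ?_
  · exact Filter.Eventually.of_forall (fun x => (Gt_meas x).aestronglyMeasurable)
  · have : ∀ᶠ x in nhds ν, ‖x‖ < ‖ν‖ + 1 :=
      continuous_norm.continuousAt.eventually_lt continuousAt_const (by linarith)
    filter_upwards [this] with x hx
    refine Filter.Eventually.of_forall (fun θ _ => (Gt_bound x θ).trans (by linarith))
  · refine Filter.Eventually.of_forall (fun θ _ => ?_)
    refine continuousAt_const.mul ?_
    refine ContinuousAt.comp (g := rt) (f := fun x => Vf x θ) ?_ (hasDerivAt_Vf ν θ).continuousAt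
    apply continuous_rt_at
    rcases h with h | h
    · left; rw [Vf_re]; positivity
    · right; exact (Vf_im_pos h θ).ne'

lemma Gf_cont {ν : ℂ} (h : 0 ≤ ν.re ∨ 0 < ν.im) : ContinuousAt Gf ν := by
  unfold Gf
  exact ContinuousAt.mul (by fun_prop) (Gt_cont h)

/-- the closed quarter disc -/
def Kc : Set ℂ := {ν | 0 ≤ ν.re ∧ 0 ≤ ν.im ∧ ‖ν‖ ≤ 1 / 2}

lemma Wf_re_ge {ν : ℂ} (h : ‖ν‖ ≤ 1 / 2) (θ : ℝ) :
    (1 - |Real.cos (2 * θ)|) / 2 ≤ (Wf ν θ).re := by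
  rw [Wf_re]
  have h1 : |ν.re * Real.cos (2 * θ)| ≤ 1 / 2 * |Real.cos (2 * θ)| := by
    rw [abs_mul]
    exact mul_le_mul_of_nonneg_right ((abs_re_le_norm ν).trans h) (abs_nonneg _)
  linarith [(abs_le.1 h1).1]

lemma abs_cos_lt {θ : ℝ} (h : Real.sin (2 * θ) ≠ 0) : |Real.cos (2 * θ)| < 1 := by
  have h1 := Real.sin_sq_add_cos_sq (2 * θ)
  have : 0 < Real.sin (2 * θ) ^ 2 := by positivity
  rw [← sq_lt_one_iff_abs_lt_one]; linarith

lemma Wf_re_pos' {ν : ℂ} (h : ‖ν‖ ≤ 1 / 2) {θ : ℝ} (hs : Real.sin (2 * θ) ≠ 0) :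
    0 < (Wf ν θ).re := by
  have := Wf_re_ge h θ
  linarith [abs_cos_lt hs]

lemma Ft_bound {ν : ℂ} (h : ‖ν‖ ≤ 1 / 2) (θ : ℝ) :
    ‖((Real.sin (2 * θ) ^ 2 : ℝ) : ℂ) * (rt (Wf ν θ))⁻¹‖ ≤ 2 := by
  by_cases hs : Real.sin (2 * θ) = 0
  · rw [hs]; simp
  rw [norm_mul, norm_real, Real.norm_eq_abs, abs_of_nonneg (by positivity), norm_inv]
  have hp := Wf_re_pos' h hs
  have hge := Wf_re_ge h θ
  have hn : 0 < ‖rt (Wf ν θ)‖ := norm_pos_iff.2 (rt_ne_zero (by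
    intro h0; rw [h0] at hp; simp at hp))
  have h1 := Real.sin_sq_add_cos_sq (2 * θ)
  have h2 := norm_rt_sq (Wf ν θ)
  have h3 := (le_abs_self _).trans (abs_re_le_norm (Wf ν θ))
  rw [← div_eq_mul_inv, div_le_iff₀ hn]
  have h5 := sq_abs (Real.cos (2 * θ))
  have h6 := abs_cos_lt hs
  have h7 := abs_nonneg (Real.cos (2 * θ))
  have h8 : Real.sin (2 * θ) ^ 2 ≤ 4 * ‖rt (Wf ν θ)‖ ^ 2 := by nlinarith
  have h9 : Real.sin (2 * θ) ^ 2 ≤ 1 := by nlinarith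
  refine le_of_sq_le_sq ?_ (by positivity)
  nlinarith [sq_nonneg (Real.sin (2 * θ))]

lemma Ft_meas (ν : ℂ) :
    Measurable (fun θ : ℝ => ((Real.sin (2 * θ) ^ 2 : ℝ) : ℂ) * (rt (Wf ν θ))⁻¹) := by
  have := (measurable_rt.comp (Wf_meas ν)).inv
  exact Measurable.mul (by fun_prop) this

lemma Ft_integrable' {ν : ℂ} (h : ‖ν‖ ≤ 1 / 2) : IntervalIntegrable
    (fun θ : ℝ => ((Real.sin (2 * θ) ^ 2 : ℝ) : ℂ) * (rt (Wf ν θ))⁻¹) volume 0 (Real.pi / 2) := by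
  refine IntervalIntegrable.mono_fun (f := fun _ : ℝ => (2 : ℝ)) ?_ (Ft_meas ν).aestronglyMeasurable ?_
  · exact intervalIntegrable_const
  · refine Filter.Eventually.of_forall (fun θ => (Ft_bound h θ).trans (le_abs_self _))

lemma Ft_contOn : ContinuousOn Ft {ν | ‖ν‖ ≤ 1 / 2} := by
  intro ν hν
  unfold Ft
  refine intervalIntegral.continuousWithinAt_of_dominated_interval
    (bound := fun _ => 2) ?_ ?_ intervalIntegrable_const ?_
  · exact Filter.Eventually.of_forall (fun x => (Ft_meas x).aestronglyMeasurable)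
  · filter_upwards [self_mem_nhdsWithin] with x hx
    refine Filter.Eventually.of_forall (fun θ _ => (Ft_bound hx θ))
  · refine Filter.Eventually.of_forall (fun θ _ => ?_)
    by_cases hs : Real.sin (2 * θ) = 0
    · simp only [hs]; simp only [ne_eq, OfNat.ofNat_ne_zero, not_false_eq_true, zero_pow, ofReal_zero, zero_mul]
      exact continuousWithinAt_const
    · apply ContinuousAt.continuousWithinAt
      have hp := Wf_re_pos' hν hs
      refine continuousAt_const.mul (ContinuousAt.inv₀ ?_ ?_)
      · exact ContinuousAt.comp (g := rt) (f := fun x => Wf x θ) (continuous_rt_at (Or.inl hp.le)) (hasDerivAt_Wf ν θ).continuousAt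
      · exact rt_ne_zero (by intro h0; rw [h0] at hp; simp at hp)

lemma Ff_contOn : ContinuousOn Ff {ν | ‖ν‖ ≤ 1 / 2} := by
  unfold Ff
  exact ContinuousOn.mul (by fun_prop) Ft_contOn

lemma int_im_zero {g : ℝ → ℂ} {a b : ℝ} (hab : a ≤ b)
    (hg : IntervalIntegrable g volume a b) (h : ∀ θ ∈ Icc a b, (g θ).im = 0) :
    (∫ θ in a..b, g θ).im = 0 := by
  have h1 := int_re_nonneg hab I hg (fun θ hθ => by simp [h θ hθ])
  have h2 := int_re_nonneg hab (-I) hg (fun θ hθ => by simp [h θ hθ])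
  simp only [neg_mul, neg_re, I_mul_re] at h1 h2
  linarith

lemma rt_im_zero {z : ℂ} (h : 0 ≤ z.re) (h' : z.im = 0) : (rt z).im = 0 := by
  obtain ⟨h1, h2⟩ := rt_re_im z
  rw [h'] at h2
  rcases mul_eq_zero.1 h2 with h3 | h3
  · have : (rt z).re = 0 := by linarith
    rw [this] at h1
    nlinarith [sq_nonneg (rt z).im]
  · exact h3

lemma Ft_real {ν : ℂ} (h : ‖ν‖ ≤ 1 / 2) (him : ν.im = 0) : 0 < (Ft ν).re ∧ (Ft ν).im = 0 := by
  constructor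
  · have := int_re_pos pi2_pos 1 (Ft_integrable' h) (fun θ hθ => by
      have hs := sin2_pos hθ
      rw [one_mul, re_ofReal_mul]
      exact mul_pos (pow_pos hs 2) (inv_re_pos (rt_re_pos
        (mem_slitPlane_iff.2 (Or.inl (Wf_re_pos' h hs.ne'))))))
    rwa [one_mul] at this
  · refine int_im_zero pi2_pos.le (Ft_integrable' h) (fun θ _ => ?_)
    rw [im_ofReal_mul, inv_im, rt_im_zero]
    · simp
    · have := Wf_re_ge h θ
      linarith [abs_cos_le (2 * θ)]
    · rw [Wf_im, him, zero_mul]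

lemma Gt_real {ν : ℂ} (h : 0 ≤ ν.re) (him : ν.im = 0) : 0 < (Gt ν).re ∧ (Gt ν).im = 0 := by
  constructor
  · have := int_re_pos pi2_pos 1 (Gt_integrable ν) (fun θ hθ => by
      have hs := cos_pos' hθ
      rw [one_mul, re_ofReal_mul]
      refine mul_pos (pow_pos hs 2) ((rt_re_pos
        (mem_slitPlane_iff.2 (Or.inl ?_))))
      rw [Vf_re]; positivity)
    rwa [one_mul] at this
  · refine int_im_zero pi2_pos.le (Gt_integrable ν) (fun θ _ => ?_)
    rw [im_ofReal_mul, rt_im_zero]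
    · simp
    · rw [Vf_re]; positivity
    · rw [Vf_im, him, zero_mul]

lemma Ff_real {ν : ℂ} (h : ‖ν‖ ≤ 1 / 2) (him : ν.im = 0) (hp : ν.re ≠ 0) :
    0 < (Ff ν).re ∧ (Ff ν).im = 0 := by
  obtain ⟨h1, h2⟩ := Ft_real h him
  have e : (3 * ν ^ 2 : ℂ) = ((3 * ν.re ^ 2 : ℝ) : ℂ) := by
    apply Complex.ext <;> simp [him, sq]
  rw [Ff, e, re_ofReal_mul, im_ofReal_mul, h2]
  exact ⟨by positivity, by simp⟩

lemma Gf_real {ν : ℂ} (h : 0 ≤ ν.re) (him : ν.im = 0) (hp : ν.re < 1 / 2) :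
    0 < (Gf ν).re ∧ (Gf ν).im = 0 := by
  obtain ⟨h1, h2⟩ := Gt_real h him
  have e : (3 * (1 / 2 - ν) : ℂ) = ((3 * (1 / 2 - ν.re) : ℝ) : ℂ) := by
    apply Complex.ext <;> simp [him]
  rw [Gf, e, re_ofReal_mul, im_ofReal_mul, h2]
  exact ⟨mul_pos (by linarith) h1, by simp⟩

lemma ray {ν : ℂ} (h : 0 < ν.im)
    (hk : ∀ s ∈ Ioo (0:ℝ) 1, 0 < ((starRingEnd ℂ) (Ft ν) * kV ((s:ℂ) * ν)).re) :
    ((starRingEnd ℂ) (Ff ν) * Gf ν).re < (Ff ν).re * (Gf 0).re := by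
  have hd : ∀ s ∈ Ioo (0:ℝ) 1, HasDerivAt (fun s : ℝ => ((starRingEnd ℂ) (Ff ν) * Gf ((s:ℂ) * ν)).re)
      ((starRingEnd ℂ) (Ff ν) * (-3 * ((s:ℂ) * ν) * kV ((s:ℂ) * ν) * ν)).re s := by
    intro s hs
    have h0 : 0 < ((s:ℂ) * ν).im := by rw [im_ofReal_mul]; exact mul_pos hs.1 h
    have h1 : HasDerivAt (fun z : ℂ => (starRingEnd ℂ) (Ff ν) * Gf (z * ν))
      ((starRingEnd ℂ) (Ff ν) * (-3 * ((s:ℂ) * ν) * kV ((s:ℂ) * ν) * ν)) (s:ℂ) := by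
      have h2 : HasDerivAt (fun z : ℂ => z * ν) ν (s:ℂ) := by
        simpa using (hasDerivAt_id (s:ℂ)).mul_const ν
      exact ((hasDerivAt_Gf h0).comp (s:ℂ) h2).const_mul _
    exact h1.real_of_complex
  have hc : ContinuousOn (fun s : ℝ => ((starRingEnd ℂ) (Ff ν) * Gf ((s:ℂ) * ν)).re) (Icc 0 1) := by
    intro s hs
    apply ContinuousAt.continuousWithinAt
    have hg : ContinuousAt Gf ((s:ℂ) * ν) := by
      apply Gf_cont
      rcases hs.1.eq_or_lt with h0 | h0
      · left; rw [← h0]; simp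
      · right; rw [im_ofReal_mul]; exact mul_pos h0 h
    have : ContinuousAt (fun s : ℝ => Gf ((s:ℂ) * ν)) s :=
      ContinuousAt.comp (g := Gf) (f := fun s : ℝ => (s:ℂ) * ν) hg (by fun_prop)
    exact Complex.continuous_re.continuousAt.comp (continuousAt_const.mul this)
  obtain ⟨s, hs, he⟩ := exists_hasDerivAt_eq_slope _ _ one_pos hc hd
  have hkk := hk s hs
  have e : ((starRingEnd ℂ) (Ff ν) * (-3 * ((s:ℂ) * ν) * kV ((s:ℂ) * ν) * ν)).re
      = -(9 * s * normSq (ν ^ 2)) * ((starRingEnd ℂ) (Ft ν) * kV ((s:ℂ) * ν)).re := by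
    rw [← re_ofReal_mul]
    congr 1
    rw [Ff]
    push_cast
    rw [normSq_eq_conj_mul_self]
    simp only [map_mul, map_pow, map_ofNat]
    ring
  rw [e] at he
  simp only [ofReal_one, one_mul, ofReal_zero, zero_mul, sub_zero, div_one] at he
  have hG0 : (Gf 0).im = 0 := (Gf_real (by simp) (by simp) (by simp)).2
  have hn : 0 < normSq (ν ^ 2) := by
    rw [normSq_pos]; apply pow_ne_zero; rintro rfl; simp at h
  have : 0 < (9 * s * normSq (ν ^ 2)) * ((starRingEnd ℂ) (Ft ν) * kV ((s:ℂ) * ν)).re :=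
    mul_pos (mul_pos (mul_pos (by norm_num) hs.1) hn) hkk
  have e2 : ((starRingEnd ℂ) (Ff ν) * Gf 0).re = (Ff ν).re * (Gf 0).re := by
    simp [mul_re, hG0]
  linarith

/-- exclusion of the closed left half-plane -/
lemma caseA {ν : ℂ} (h : 0 < ν.im) (h' : ν.re ≤ 0)
    (hsg : (0 < (Ff ν).re ∧ 0 < (Ff ν).im) ∨ (Ff ν).re ≤ 0) :
    ((starRingEnd ℂ) (Ff ν) * Gf ν).re < 0 := by
  have hr := ray h (fun s hs => by
    have h0 : 0 < ((s:ℂ) * ν).im := by rw [im_ofReal_mul]; exact mul_pos hs.1 h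
    have h1 := Ft_re_pos h
    have h2 := Ft_im_nonpos h h'
    have h3 := kV_re_pos h0
    have h4 := kV_im_neg h0
    simp only [mul_re, conj_re, conj_im]
    nlinarith [mul_pos h1 h3])
  have hG := (Gf_real (ν := 0) (by simp) (by simp) (by simp)).1
  rcases hsg with ⟨h1, h2⟩ | h1
  · exfalso
    have a1 := Ft_re_pos h
    have a2 := Ft_im_nonpos h h'
    have e : (3 * normSq (Ft ν) : ℝ) * ν ^ 2 = Ff ν * (starRingEnd ℂ) (Ft ν) := by
      rw [Ff, mul_assoc, mul_conj]; push_cast; ring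
    have e1 := congrArg Complex.im e
    rw [im_ofReal_mul] at e1
    simp only [mul_im, conj_re, conj_im, sq] at e1
    have hn : 0 ≤ normSq (Ft ν) := normSq_nonneg _
    have b1 : 0 < (Ff ν).re * -(Ft ν).im + (Ff ν).im * (Ft ν).re := by
      nlinarith [mul_pos h2 a1]
    have b2 : ν.re * ν.im ≤ 0 := mul_nonpos_of_nonpos_of_nonneg h' h.le
    have b3 : 3 * normSq (Ft ν) * (ν.re * ν.im + ν.im * ν.re) ≤ 0 :=
      mul_nonpos_of_nonneg_of_nonpos (by positivity) (by linarith)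
    linarith
  · nlinarith [mul_nonneg (neg_nonneg.2 h1) hG.le]

lemma polar (z : ℂ) : z = (‖z‖ : ℂ) * exp ((arg z : ℝ) * I) := (norm_mul_exp_arg_mul_I z).symm

lemma polar_conj (z : ℂ) : (starRingEnd ℂ) z = (‖z‖ : ℂ) * exp ((-arg z : ℝ) * I) := by
  conv_lhs => rw [polar z]
  rw [map_mul, ← exp_conj, conj_ofReal, map_mul, conj_ofReal, conj_I]
  push_cast; ring_nf

lemma rt_polar {z : ℂ} (h : z ∈ slitPlane) :
    rt z = (Real.sqrt ‖z‖ : ℂ) * exp ((arg z / 2 : ℝ) * I) := by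
  have hz := slitPlane_ne_zero h
  have ha := (mem_slitPlane_iff_arg.1 h).1
  have h1 := neg_pi_lt_arg z
  have h2 := arg_le_pi z
  have h2' : arg z < Real.pi := lt_of_le_of_ne h2 ha
  apply rt_unique
  · rw [mul_pow, ← ofReal_pow, Real.sq_sqrt (norm_nonneg _), ← exp_nat_mul]
    conv_rhs => rw [polar z]
    push_cast; ring_nf
  · rw [re_ofReal_mul, exp_ofReal_mul_I_re]
    exact mul_pos (Real.sqrt_pos.2 (norm_pos_iff.2 hz))
      (Real.cos_pos_of_mem_Ioo ⟨by linarith, by linarith⟩)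

lemma im_mul_conj_polar (z w : ℂ) :
    (z * (starRingEnd ℂ) w).im = ‖z‖ * ‖w‖ * Real.sin (arg z - arg w) := by
  have e : z * (starRingEnd ℂ) w = ((‖z‖ * ‖w‖ : ℝ) : ℂ) * exp ((arg z - arg w : ℝ) * I) := by
    conv_lhs => rw [polar_conj w, polar z]
    have : ((arg z - arg w : ℝ) : ℂ) * I = (arg z : ℝ) * I + (-arg w : ℝ) * I := by
      push_cast; ring
    rw [this, exp_add]; push_cast; ring
  rw [e, im_ofReal_mul, exp_ofReal_mul_I_im]

lemma arg_le_of {z w : ℂ} (hz : z ≠ 0) (hw : w ≠ 0) (hd : arg w - arg z < Real.pi)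
    (h : 0 ≤ (z * (starRingEnd ℂ) w).im) : arg w ≤ arg z := by
  rw [im_mul_conj_polar] at h
  by_contra hn
  push Not at hn
  have h1 := Real.sin_pos_of_pos_of_lt_pi (x := arg w - arg z) (by linarith) hd
  have h2 : Real.sin (arg z - arg w) = - Real.sin (arg w - arg z) := by
    rw [← Real.sin_neg]; ring_nf
  rw [h2] at h
  have : 0 < ‖z‖ * ‖w‖ := mul_pos (norm_pos_iff.2 hz) (norm_pos_iff.2 hw)
  nlinarith [mul_pos this h1]

lemma arg_lt_of {z w : ℂ} (hz : z ≠ 0) (hw : w ≠ 0) (hd : arg w - arg z < Real.pi)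
    (h : 0 < (z * (starRingEnd ℂ) w).im) : arg w < arg z := by
  refine lt_of_le_of_ne (arg_le_of hz hw hd h.le) ?_
  intro he
  rw [im_mul_conj_polar, he] at h
  simp at h

lemma arg_mem_of_im_pos {z : ℂ} (h : 0 < z.im) : 0 < arg z ∧ arg z < Real.pi := by
  have h0 : 0 ≤ arg z := arg_nonneg_iff.2 h.le
  have h1 : arg z ≠ 0 := fun he => by
    have := (arg_eq_zero_iff.1 he).2; linarith
  have h2 : arg z ≠ Real.pi := fun he => by
    have := (arg_eq_pi_iff.1 he).2; linarith
  exact ⟨lt_of_le_of_ne h0 h1.symm, lt_of_le_of_ne (arg_le_pi z) h2⟩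

lemma ne_of_im_pos {z : ℂ} (h : 0 < z.im) : z ≠ 0 := by rintro rfl; simp at h

set_option maxHeartbeats 1000000 in
/-- pointwise inequality behind the exclusion of `‖ν‖ ≥ 1/2` -/
lemma caseB_point {ν : ℂ} (hx : 0 < ν.re) (hy : 0 < ν.im) (hn : 1 / 2 ≤ ‖ν‖) (θ θ' : ℝ) :
    (ν ^ 2 * (1 / 2 - (starRingEnd ℂ) ν) * (rt (Wf ν θ))⁻¹ * (starRingEnd ℂ) (rt (Vf ν θ'))).re
      < 0 := by
  obtain ⟨b, hb⟩ : ∃ b : ℂ, b = 1 / 2 - (starRingEnd ℂ) ν := ⟨_, rfl⟩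
  obtain ⟨e, he⟩ : ∃ e : ℂ, e = 1 / 2 + ν := ⟨_, rfl⟩
  have hbre : b.re = 1 / 2 - ν.re := by rw [hb]; simp
  have hbim : b.im = ν.im := by rw [hb]; simp
  have here : e.re = 1 / 2 + ν.re := by rw [he]; simp
  have heim : e.im = ν.im := by rw [he]; simp
  have hy' : 0 < b.im := by rw [hbim]; exact hy
  have hy'' : 0 < e.im := by rw [heim]; exact hy
  have hWs := Wf_slit hy θ
  have hVp := Vf_im_pos hy θ'
  have hVs := Vf_slit hy θ'
  have hW0 := slitPlane_ne_zero hWs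
  have hV0 := slitPlane_ne_zero hVs
  have hν0 := ne_of_im_pos hy
  have hb0 := ne_of_im_pos hy'
  have he0 := ne_of_im_pos hy''
  obtain ⟨c1, c2⟩ := arg_mem_of_im_pos hy
  obtain ⟨p1, p2⟩ := arg_mem_of_im_pos hy'
  obtain ⟨e1, e2⟩ := arg_mem_of_im_pos hy''
  obtain ⟨v1, v2⟩ := arg_mem_of_im_pos hVp
  have c3 : arg ν < Real.pi / 2 := by
    have := (abs_arg_lt_pi_div_two_iff (z := ν)).2 (Or.inl hx)
    exact (abs_lt.1 this).2
  have e3 : arg e < Real.pi / 2 := by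
    have := (abs_arg_lt_pi_div_two_iff (z := e)).2 (Or.inl (by rw [here]; linarith))
    exact (abs_lt.1 this).2
  have hpi := Real.pi_pos
  have hcos := abs_le.1 (abs_cos_le (2 * θ))
  -- arg W ≤ arg e
  have w1 : arg (Wf ν θ) ≤ arg e := by
    by_cases h0 : arg (Wf ν θ) ≤ 0
    · linarith
    · push Not at h0
      apply arg_le_of he0 hW0 (by linarith [arg_le_pi (Wf ν θ)])
      simp only [mul_im, conj_re, conj_im, Wf_re, Wf_im, here, heim]
      nlinarith [mul_nonneg hy.le (sub_nonneg.2 hcos.2)]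
  have w2 : -arg b ≤ arg (Wf ν θ) := by
    by_cases h0 : 0 ≤ arg (Wf ν θ)
    · linarith
    · push Not at h0
      have hc : arg ((starRingEnd ℂ) b) = - arg b := by
        rw [arg_conj, if_neg p2.ne]
      rw [← hc]
      apply arg_le_of hW0 (by simpa using hb0) (by rw [hc]; linarith [neg_pi_lt_arg (Wf ν θ)])
      simp only [conj_conj, mul_im, Wf_re, Wf_im, hbre, hbim]
      nlinarith [mul_nonneg hy.le (by linarith : (0:ℝ) ≤ 1 + Real.cos (2 * θ))]
  have hsc := Real.sin_sq_add_cos_sq θ'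
  have vv1 : arg e ≤ arg (Vf ν θ') := by
    apply arg_le_of hV0 he0 (by linarith)
    simp only [mul_im, conj_re, conj_im, Vf_re, Vf_im, here, heim]
    nlinarith [mul_nonneg hy.le (sq_nonneg (Real.sin θ'))]
  have vv2 : arg (Vf ν θ') ≤ arg ν := by
    apply arg_le_of hν0 hV0 (by linarith)
    simp only [mul_im, conj_re, conj_im, Vf_re, Vf_im]
    nlinarith [mul_nonneg hy.le (sq_nonneg (Real.cos θ'))]
  have ce : arg e < arg ν := by
    apply arg_lt_of hν0 he0 (by linarith)
    simp only [mul_im, conj_re, conj_im, here, heim]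
    nlinarith
  have nν := norm_pos_iff.2 hν0
  have nb := norm_pos_iff.2 hb0
  have ne := norm_pos_iff.2 he0
  have pe : arg b + arg e < Real.pi := by
    by_contra hcon
    push Not at hcon
    have h1 : b * e = ((‖b‖ * ‖e‖ : ℝ) : ℂ) * exp ((arg b + arg e : ℝ) * I) := by
      conv_lhs => rw [polar b, polar e]
      rw [ofReal_add, add_mul, exp_add]; push_cast; ring
    have h2 := congrArg Complex.im h1
    rw [im_ofReal_mul, exp_ofReal_mul_I_im, mul_im, hbre, hbim, here, heim] at h2
    have h3 : Real.sin (arg b + arg e) ≤ 0 := by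
      have h4 : 0 ≤ Real.sin (arg b + arg e - Real.pi) :=
        Real.sin_nonneg_of_nonneg_of_le_pi (by linarith) (by linarith)
      rw [Real.sin_sub_pi] at h4; linarith
    nlinarith [mul_pos nb ne]
  have nsq : 1 / 4 ≤ ν.re * ν.re + ν.im * ν.im := by
    have h1 : ‖ν‖ * ‖ν‖ = normSq ν := norm_mul_self_eq_normSq ν
    rw [normSq_apply] at h1
    nlinarith
  have pc : Real.pi ≤ 2 * arg b + arg ν := by
    by_contra hcon
    push Not at hcon
    have h1 : ν * b ^ 2 = ((‖ν‖ * ‖b‖ ^ 2 : ℝ) : ℂ) * exp ((2 * arg b + arg ν : ℝ) * I) := by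
      conv_lhs => rw [polar b, polar ν]
      have : ((2 * arg b + arg ν : ℝ) : ℂ) * I = (arg b : ℝ) * I + (arg b : ℝ) * I + (arg ν : ℝ) * I := by
        push_cast; ring
      rw [this, exp_add, exp_add]; push_cast; ring
    have h2 := congrArg Complex.im h1
    rw [im_ofReal_mul, exp_ofReal_mul_I_im, sq, mul_im, mul_im, mul_re, hbre, hbim] at h2
    have h3 : 0 < Real.sin (2 * arg b + arg ν) :=
      Real.sin_pos_of_pos_of_lt_pi (by linarith) hcon
    have h4 : 0 < ‖ν‖ * ‖b‖ ^ 2 * Real.sin (2 * arg b + arg ν) := by positivity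
    nlinarith [mul_nonneg hy.le (sub_nonneg.2 nsq)]
  have up : 2 * arg ν + arg b - arg e ≤ Real.pi := by
    by_contra hcon
    push Not at hcon
    have h1 : ν ^ 2 * b * (starRingEnd ℂ) e =
        ((‖ν‖ ^ 2 * ‖b‖ * ‖e‖ : ℝ) : ℂ) * exp ((2 * arg ν + arg b - arg e : ℝ) * I) := by
      conv_lhs => rw [polar_conj e, polar b, polar ν]
      have : ((2 * arg ν + arg b - arg e : ℝ) : ℂ) * I = (arg ν : ℝ) * I + (arg ν : ℝ) * I + (arg b : ℝ) * I
          + (-arg e : ℝ) * I := by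
        push_cast; ring
      rw [this, exp_add, exp_add, exp_add]; push_cast; ring
    have h2 := congrArg Complex.im h1
    rw [im_ofReal_mul, exp_ofReal_mul_I_im] at h2
    simp only [mul_im, mul_re, sq, conj_re, conj_im, hbre, hbim, here, heim] at h2
    have h3 : Real.sin (2 * arg ν + arg b - arg e) ≤ 0 := by
      have h4 : 0 ≤ Real.sin (2 * arg ν + arg b - arg e - Real.pi) :=
        Real.sin_nonneg_of_nonneg_of_le_pi (by linarith) (by linarith)
      rw [Real.sin_sub_pi] at h4; linarith
    have h5 : ν.re * ν.im / 2 =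
        ‖ν‖ * ‖ν‖ * ‖b‖ * ‖e‖ * Real.sin (2 * arg ν + arg b - arg e) := by
      rw [← h2]; ring
    have h6 : ‖ν‖ * ‖ν‖ * ‖b‖ * ‖e‖ * Real.sin (2 * arg ν + arg b - arg e) ≤ 0 :=
      mul_nonpos_of_nonneg_of_nonpos (by positivity) h3
    linarith [mul_pos hx hy]
  have key : ν ^ 2 * b * (rt (Wf ν θ))⁻¹ * (starRingEnd ℂ) (rt (Vf ν θ')) =
      ((‖ν‖ ^ 2 * ‖b‖ * (Real.sqrt ‖Wf ν θ‖)⁻¹ * Real.sqrt ‖Vf ν θ'‖ : ℝ) : ℂ) *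
      exp ((2 * arg ν + arg b - arg (Wf ν θ) / 2 - arg (Vf ν θ') / 2 : ℝ) * I) := by
    have hcv : (starRingEnd ℂ) (rt (Vf ν θ')) =
        (Real.sqrt ‖Vf ν θ'‖ : ℂ) * exp ((-(arg (Vf ν θ') / 2) : ℝ) * I) := by
      rw [rt_polar hVs, map_mul, ← exp_conj, conj_ofReal, map_mul, conj_ofReal, conj_I]
      push_cast; ring_nf
    have hwi : (rt (Wf ν θ))⁻¹ = (Real.sqrt ‖Wf ν θ‖ : ℂ)⁻¹ * exp ((-(arg (Wf ν θ) / 2) : ℝ) * I) := by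
      rw [rt_polar hWs, mul_inv, ← exp_neg]
      push_cast; ring_nf
    have hnb : ν ^ 2 * b = (‖ν‖ : ℂ) ^ 2 * ‖b‖ *
        (exp ((arg ν : ℝ) * I) * exp ((arg ν : ℝ) * I) * exp ((arg b : ℝ) * I)) := by
      conv_lhs => rw [polar b, polar ν]
      ring
    rw [hcv, hwi, hnb]
    have : ((2 * arg ν + arg b - arg (Wf ν θ) / 2 - arg (Vf ν θ') / 2 : ℝ) : ℂ) * I
       = (arg ν : ℝ) * I + (arg ν : ℝ) * I + (arg b : ℝ) * I
          + (-(arg (Wf ν θ) / 2) : ℝ) * I + (-(arg (Vf ν θ') / 2) : ℝ) * I := by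
        push_cast; ring
    rw [this, exp_add, exp_add, exp_add, exp_add]; push_cast; ring
  rw [← hb, key, re_ofReal_mul, exp_ofReal_mul_I_re]
  have hc := Real.cos_neg_of_pi_div_two_lt_of_lt
    (x := 2 * arg ν + arg b - arg (Wf ν θ) / 2 - arg (Vf ν θ') / 2) (by linarith) (by linarith)
  have hWn := Real.sqrt_pos.2 (norm_pos_iff.2 hW0)
  have hVn := Real.sqrt_pos.2 (norm_pos_iff.2 hV0)
  exact mul_neg_of_pos_of_neg (by positivity) hc

lemma caseB {ν : ℂ} (hx : 0 < ν.re) (hy : 0 < ν.im) (hn : 1 / 2 ≤ ‖ν‖) :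
    ((starRingEnd ℂ) (Ff ν) * Gf ν).re < 0 := by
  have h1 : 0 < (-((starRingEnd ℂ) (ν ^ 2 * (1 / 2 - (starRingEnd ℂ) ν) * Ft ν)) * Gt ν).re := by
    refine int_re_pos pi2_pos _ (Gt_integrable ν) (fun θ' hθ' => ?_)
    have h2 := int_re_pos pi2_pos
      (-(ν ^ 2 * (1 / 2 - (starRingEnd ℂ) ν) * (starRingEnd ℂ) (rt (Vf ν θ'))))
      (Ft_integrable hy) (fun θ hθ => by
        have h3 := caseB_point hx hy hn θ θ'
        have h4 : 0 < Real.sin (2 * θ) ^ 2 := pow_pos (sin2_pos hθ) 2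
        have e : -(ν ^ 2 * (1 / 2 - (starRingEnd ℂ) ν) * (starRingEnd ℂ) (rt (Vf ν θ'))) *
          (((Real.sin (2 * θ) ^ 2 : ℝ) : ℂ) * (rt (Wf ν θ))⁻¹) =
          ((Real.sin (2 * θ) ^ 2 : ℝ) : ℂ) * -(ν ^ 2 * (1 / 2 - (starRingEnd ℂ) ν) * (rt (Wf ν θ))⁻¹ * (starRingEnd ℂ) (rt (Vf ν θ'))) := by ring
        rw [e, re_ofReal_mul, neg_re]
        exact mul_pos h4 (by linarith))
    have hc : 0 < Real.cos θ' ^ 2 := pow_pos (cos_pos' hθ') 2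
    have e : (-(starRingEnd ℂ) (ν ^ 2 * (1 / 2 - (starRingEnd ℂ) ν) * Ft ν) *
        (((Real.cos θ' ^ 2 : ℝ) : ℂ) * rt (Vf ν θ'))) = ((Real.cos θ' ^ 2 : ℝ) : ℂ) *
        (starRingEnd ℂ) (-(ν ^ 2 * (1 / 2 - (starRingEnd ℂ) ν) * (starRingEnd ℂ) (rt (Vf ν θ'))) * Ft ν) := by
      simp only [map_mul, map_neg, conj_conj]; ring
    rw [e, re_ofReal_mul, conj_re]
    exact mul_pos hc h2
  have e : (starRingEnd ℂ) (Ff ν) * Gf ν = ((-9 : ℝ) : ℂ) * (-((starRingEnd ℂ) (ν ^ 2 * (1 / 2 - (starRingEnd ℂ) ν) * Ft ν)) * Gt ν) := by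
    rw [Ff, Gf]
    simp only [map_mul, map_pow, map_sub, conj_conj, map_ofNat, map_div₀, map_one]
    push_cast; ring
  rw [e, re_ofReal_mul]
  linarith

/-- the reduced Boutroux system -/
def Sol (θ : ℝ) (ν : ℂ) : Prop := (exp (θ * I) * Ff ν).re = 0 ∧ (exp (θ * I) * Gf ν).im = 0

/-- the open quarter disc -/
def Om : Set ℂ := {ν | 0 < ν.re ∧ 0 < ν.im ∧ ‖ν‖ < 1 / 2}

lemma conj_exp_mul (θ : ℝ) (a b : ℂ) :
    (starRingEnd ℂ) (exp (θ * I) * a) * (exp (θ * I) * b) = (starRingEnd ℂ) a * b := by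
  have h : (starRingEnd ℂ) (exp (θ * I)) * exp (θ * I) = 1 := by
    rw [← normSq_eq_conj_mul_self, normSq_eq_norm_sq, norm_exp_ofReal_mul_I]; simp
  rw [map_mul]
  linear_combination ((starRingEnd ℂ) a * b) * h

lemma cross_zero {θ : ℝ} {a b : ℂ} (h1 : (exp (θ * I) * a).re = 0) (h2 : (exp (θ * I) * b).im = 0) :
    ((starRingEnd ℂ) a * b).re = 0 := by
  rw [← conj_exp_mul θ a b, mul_re, conj_re, conj_im, h1, h2]; ring

lemma trig_neg {θ : ℝ} (hθ : θ ∈ Ioo Real.pi (3 * Real.pi / 2)) :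
    Real.cos θ < 0 ∧ Real.sin θ < 0 := by
  constructor
  · exact Real.cos_neg_of_pi_div_two_lt_of_lt (by linarith [hθ.1, Real.pi_pos]) (by linarith [hθ.2])
  · have := Real.sin_pos_of_pos_of_lt_pi (x := θ - Real.pi) (by linarith [hθ.1])
      (by linarith [hθ.2, Real.pi_pos])
    rw [Real.sin_sub_pi] at this; linarith

lemma sol_sign {θ : ℝ} (hθ : θ ∈ Ioo Real.pi (3 * Real.pi / 2)) {f : ℂ}
    (h1 : (exp (θ * I) * f).re = 0) : (0 < f.re ∧ 0 < f.im) ∨ f.re ≤ 0 := by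
  obtain ⟨hc, hs⟩ := trig_neg hθ
  rw [mul_re, exp_ofReal_mul_I_re, exp_ofReal_mul_I_im] at h1
  by_cases h : f.re ≤ 0
  · exact Or.inr h
  · push Not at h
    left; refine ⟨h, ?_⟩
    by_contra hn
    push Not at hn
    nlinarith [mul_neg_of_neg_of_pos hc h, mul_nonneg_of_nonpos_of_nonpos hs.le hn]

lemma sol_mem_Om {θ : ℝ} (hθ : θ ∈ Ioo Real.pi (3 * Real.pi / 2)) {ν : ℂ} (h : 0 < ν.im)
    (hs : Sol θ ν) : ν ∈ Om := by
  have hq := cross_zero hs.1 hs.2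
  have hre : 0 < ν.re := by
    by_contra hn
    push Not at hn
    have := caseA h hn (sol_sign hθ hs.1)
    linarith
  refine ⟨hre, h, ?_⟩
  by_contra hn
  push Not at hn
  have := caseB hre h hn
  linarith

lemma seg_re {F k : ℂ → ℂ} (hF : ∀ ν : ℂ, 0 < ν.im → HasDerivAt F (3 * ν * k ν) ν) (u : ℂ)
    (hk : ∀ ν ∈ Om, 0 < (u * k ν).re) {ν₁ ν₂ : ℂ} (h1 : ν₁ ∈ Om) (h2 : ν₂ ∈ Om) (hne : ν₁ ≠ ν₂) :
    0 < (u * ((starRingEnd ℂ) (ν₂ ^ 2 - ν₁ ^ 2) * (F ν₂ - F ν₁))).re := by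
  set D := ν₂ ^ 2 - ν₁ ^ 2 with hD
  have r1 : rt (ν₁ ^ 2) = ν₁ := rt_unique rfl h1.1
  have r2 : rt (ν₂ ^ 2) = ν₂ := rt_unique rfl h2.1
  have hD0 : D ≠ 0 := by
    intro h0
    apply hne
    rw [← r1, ← r2, sub_eq_zero.1 h0]
  have hw : ∀ s ∈ Icc (0:ℝ) 1, 0 < (ν₁ ^ 2 + (s:ℂ) * D).im ∧ ‖ν₁ ^ 2 + (s:ℂ) * D‖ < 1 / 4 := by
    intro s hs
    have e : ν₁ ^ 2 + (s:ℂ) * D = ((1 - s : ℝ) : ℂ) * ν₁ ^ 2 + (s:ℂ) * ν₂ ^ 2 := by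
      rw [hD]; push_cast; ring
    constructor
    · rw [e, add_im, im_ofReal_mul, im_ofReal_mul, sq, sq, mul_im, mul_im]
      have a1 := mul_pos h1.1 h1.2.1
      have a2 := mul_pos h2.1 h2.2.1
      rcases hs.1.eq_or_lt with h0 | h0
      · rw [← h0]; nlinarith
      · nlinarith [mul_pos h0 a2, mul_nonneg (sub_nonneg.2 hs.2) a1.le]
    · rw [e]
      have b1 : ‖ν₁ ^ 2‖ < 1 / 4 := by rw [norm_pow]; nlinarith [h1.2.2, norm_nonneg ν₁]
      have b2 : ‖ν₂ ^ 2‖ < 1 / 4 := by rw [norm_pow]; nlinarith [h2.2.2, norm_nonneg ν₂]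
      refine (norm_add_le _ _).trans_lt ?_
      rw [norm_mul, norm_mul, norm_real, norm_real, Real.norm_eq_abs, Real.norm_eq_abs,
        abs_of_nonneg hs.1, abs_of_nonneg (sub_nonneg.2 hs.2)]
      rcases hs.1.eq_or_lt with h0 | h0
      · rw [← h0]; linarith
      · nlinarith [mul_lt_mul_of_pos_left b2 h0, mul_le_mul_of_nonneg_left b1.le (sub_nonneg.2 hs.2)]
  have hOm : ∀ s ∈ Icc (0:ℝ) 1, rt (ν₁ ^ 2 + (s:ℂ) * D) ∈ Om := by
    intro s hs
    obtain ⟨a, b⟩ := hw s hs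
    refine ⟨rt_re_pos (mem_slitPlane_iff.2 (Or.inr a.ne')), rt_im_pos a, ?_⟩
    have := norm_rt_sq (ν₁ ^ 2 + (s:ℂ) * D)
    nlinarith [norm_nonneg (rt (ν₁ ^ 2 + (s:ℂ) * D))]
  have hd : ∀ s ∈ Icc (0:ℝ) 1, HasDerivAt
      (fun s : ℝ => (u * (starRingEnd ℂ) D * F (rt (ν₁ ^ 2 + (s:ℂ) * D))).re)
      (3 / 2 * normSq D * (u * k (rt (ν₁ ^ 2 + (s:ℂ) * D))).re) s := by
    intro s hs
    have hm := hOm s hs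
    have hsl : ν₁ ^ 2 + (s:ℂ) * D ∈ slitPlane := mem_slitPlane_iff.2 (Or.inr (hw s hs).1.ne')
    have g1 : HasDerivAt (fun z : ℂ => ν₁ ^ 2 + z * D) D (s:ℂ) := by
      simpa using ((hasDerivAt_id (s:ℂ)).mul_const D).const_add (ν₁ ^ 2)
    have g2 := (hasDerivAt_rt hsl).comp (s:ℂ) g1
    have g3 := ((hF _ hm.2.1).comp (s:ℂ) g2).const_mul (u * (starRingEnd ℂ) D)
    refine g3.real_of_complex.congr_deriv ?_
    rw [← re_ofReal_mul]
    congr 1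
    have hr0 : rt (ν₁ ^ 2 + (s:ℂ) * D) ≠ 0 := ne_of_im_pos hm.2.1
    push_cast
    rw [normSq_eq_conj_mul_self]
    field_simp
  have hc : ContinuousOn (fun s : ℝ => (u * (starRingEnd ℂ) D * F (rt (ν₁ ^ 2 + (s:ℂ) * D))).re)
      (Icc 0 1) := fun s hs => (hd s hs).continuousAt.continuousWithinAt
  obtain ⟨s, hs, he⟩ := exists_hasDerivAt_eq_slope _ _ one_pos hc
    (fun s hs => hd s (Ioo_subset_Icc_self hs))
  have hp := hk _ (hOm s (Ioo_subset_Icc_self hs))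
  have hn : 0 < normSq D := normSq_pos.2 hD0
  have hpp : 0 < 3 / 2 * normSq D * (u * k (rt (ν₁ ^ 2 + (s:ℂ) * D))).re := by positivity
  rw [he] at hpp
  have e2 : ν₁ ^ 2 + D = ν₂ ^ 2 := by rw [hD]; ring
  simp only [ofReal_one, one_mul, ofReal_zero, zero_mul, add_zero, sub_zero, div_one, e2, r1, r2] at hpp
  rw [← sub_re, ← mul_sub] at hpp
  rwa [← mul_assoc]

lemma cone_iff {X : ℂ} (h1 : 0 < ((1 + I) * X).re) (h2 : 0 < ((1 - I) * X).re) : |X.im| < X.re := by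
  simp [add_mul, sub_mul] at h1 h2
  rw [abs_lt]; constructor <;> linarith

lemma cone_of {X : ℂ} (h : |X.im| < X.re) : 0 < ((1 + I) * X).re ∧ 0 < ((1 - I) * X).re := by
  have := abs_lt.1 h
  constructor <;> simp [add_mul, sub_mul] <;> linarith [this.1, this.2]

lemma seg_cone {F k : ℂ → ℂ} (hF : ∀ ν : ℂ, 0 < ν.im → HasDerivAt F (3 * ν * k ν) ν)
    (hk : ∀ ν ∈ Om, |(k ν).im| < (k ν).re) {ν₁ ν₂ : ℂ} (h1 : ν₁ ∈ Om) (h2 : ν₂ ∈ Om) (hne : ν₁ ≠ ν₂) :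
    |((starRingEnd ℂ) (ν₂ ^ 2 - ν₁ ^ 2) * (F ν₂ - F ν₁)).im| <
      ((starRingEnd ℂ) (ν₂ ^ 2 - ν₁ ^ 2) * (F ν₂ - F ν₁)).re :=
  cone_iff (seg_re hF _ (fun ν hν => (cone_of (hk ν hν)).1) h1 h2 hne)
    (seg_re hF _ (fun ν hν => (cone_of (hk ν hν)).2) h1 h2 hne)

lemma sol_unique {θ : ℝ} {ν₁ ν₂ : ℂ} (h1 : ν₁ ∈ Om) (h2 : ν₂ ∈ Om)
    (s1 : Sol θ ν₁) (s2 : Sol θ ν₂) : ν₁ = ν₂ := by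
  by_contra hne
  have hX := seg_cone (F := Ff) (k := kW) (fun ν hν => hasDerivAt_Ff hν)
    (fun ν hν => kW_cone hν.2.1 hν.2.2) h1 h2 hne
  have hY := seg_cone (F := fun ν => - Gf ν) (k := kV)
    (fun ν hν => (hasDerivAt_Gf hν).neg.congr_deriv (by ring))
    (fun ν hν => kV_cone hν.2.1 hν.1.le) h1 h2 hne
  have hp := cone_mul_pos hX hY
  have hz : ((starRingEnd ℂ) (Ff ν₂ - Ff ν₁) * (Gf ν₂ - Gf ν₁)).re = 0 := by
    apply cross_zero (θ := θ)
    · rw [mul_sub, sub_re, s1.1, s2.1, sub_zero]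
    · rw [mul_sub, sub_im, s1.2, s2.2, sub_zero]
  have e : (starRingEnd ℂ) ((starRingEnd ℂ) (ν₂ ^ 2 - ν₁ ^ 2) * (Ff ν₂ - Ff ν₁)) *
      ((starRingEnd ℂ) (ν₂ ^ 2 - ν₁ ^ 2) * (- Gf ν₂ - - Gf ν₁)) =
      ((-normSq (ν₂ ^ 2 - ν₁ ^ 2) : ℝ) : ℂ) * ((starRingEnd ℂ) (Ff ν₂ - Ff ν₁) * (Gf ν₂ - Gf ν₁)) := by
    rw [map_mul, conj_conj, ofReal_neg, normSq_eq_conj_mul_self]; ring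
  rw [e, re_ofReal_mul, hz, mul_zero] at hp
  exact lt_irrefl _ hp

lemma sol_boundary {θ : ℝ} (hθ : θ ∈ Ioo Real.pi (3 * Real.pi / 2)) {ν : ℂ} (h : ν ∈ Kc)
    (hs : Sol θ ν) : ν ∈ Om := by
  obtain ⟨hr, hi, hn⟩ := h
  rcases hi.lt_or_eq with h0 | h0
  · exact sol_mem_Om hθ h0 hs
  · exfalso
    obtain ⟨hc, hsn⟩ := trig_neg hθ
    by_cases hz : ν.re = 0
    · obtain ⟨a, b⟩ := Gf_real hr h0.symm (by rw [hz]; norm_num)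
      have := hs.2
      rw [mul_im, exp_ofReal_mul_I_re, exp_ofReal_mul_I_im, b, mul_zero, zero_add] at this
      nlinarith [mul_neg_of_neg_of_pos hsn a]
    · obtain ⟨a, b⟩ := Ff_real hn h0.symm hz
      have := hs.1
      rw [mul_re, exp_ofReal_mul_I_re, exp_ofReal_mul_I_im, b, mul_zero, sub_zero] at this
      nlinarith [mul_neg_of_neg_of_pos hc a]

lemma solve_lin (A B : ℂ) (hR : ((starRingEnd ℂ) B * A).re ≠ 0) (a b : ℝ) :
    ∃ z : ℂ, (A * z).re = a ∧ (B * z).im = b := by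
  set R := ((starRingEnd ℂ) B * A).re with hRd
  refine ⟨((R⁻¹ : ℝ) : ℂ) * ((starRingEnd ℂ) B * a + I * (starRingEnd ℂ) A * b), ?_, ?_⟩
  · have e : A * (((R⁻¹ : ℝ) : ℂ) * ((starRingEnd ℂ) B * a + I * (starRingEnd ℂ) A * b)) =
      ((R⁻¹ : ℝ) : ℂ) * ((a : ℂ) * ((starRingEnd ℂ) B * A) + I * ((b * normSq A : ℝ) : ℂ)) := by
      push_cast
      rw [normSq_eq_conj_mul_self]; ring
    rw [e, re_ofReal_mul, add_re, re_ofReal_mul, I_mul_re, ofReal_im, ← hRd]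
    field_simp; ring
  · have e : B * (((R⁻¹ : ℝ) : ℂ) * ((starRingEnd ℂ) B * a + I * (starRingEnd ℂ) A * b)) =
      ((R⁻¹ : ℝ) : ℂ) * (((a * normSq B : ℝ) : ℂ) + (b : ℂ) * (I * (starRingEnd ℂ) ((starRingEnd ℂ) B * A))) := by
      push_cast
      rw [normSq_eq_conj_mul_self, map_mul, conj_conj]; ring
    rw [e, im_ofReal_mul, add_im, im_ofReal_mul, I_mul_im, ofReal_im, conj_re, ← hRd]
    field_simp; ring

lemma isOpen_Om : IsOpen Om := by
  have h1 : IsOpen {ν : ℂ | 0 < ν.re} := isOpen_lt continuous_const continuous_re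
  have h2 : IsOpen {ν : ℂ | 0 < ν.im} := isOpen_lt continuous_const continuous_im
  have h3 : IsOpen {ν : ℂ | ‖ν‖ < 1 / 2} := isOpen_lt continuous_norm continuous_const
  exact h1.inter (h2.inter h3)

lemma strict_of {F F' : ℂ → ℂ} (hF : ∀ ν : ℂ, 0 < ν.im → HasDerivAt F (F' ν) ν)
    {ν : ℂ} (h : 0 < ν.im) : HasStrictDerivAt F (F' ν) ν := by
  have ho : IsOpen {ν : ℂ | 0 < ν.im} := isOpen_lt continuous_const continuous_im
  have hd : DifferentiableOn ℂ F {ν : ℂ | 0 < ν.im} :=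
    fun x hx => (hF x hx).differentiableAt.differentiableWithinAt
  have ha := (hd.analyticAt (ho.mem_nhds h)).hasStrictDerivAt
  rwa [(hF ν h).deriv] at ha

lemma strict_prod {F : ℂ → ℂ} {α ν : ℂ} (θ : ℝ) (hF : HasStrictDerivAt F α ν) :
    ∃ L : ℂ × ℝ →L[ℝ] ℂ, HasStrictFDerivAt (fun p : ℂ × ℝ => exp ((p.2 : ℂ) * I) * F p.1) L (ν, θ) ∧
      ∀ z t, L (z, t) = exp (θ * I) * α * z + (t : ℂ) * L (0, 1) := by
  have h1 : HasStrictFDerivAt (fun p : ℂ × ℝ => F p.1) _ (ν, θ) :=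
    (hF.hasStrictFDerivAt.restrictScalars ℝ).comp (ν, θ) hasStrictFDerivAt_fst
  have h2 : HasStrictFDerivAt (fun p : ℂ × ℝ => ((p.2 : ℝ) : ℂ)) _ (ν, θ) :=
    (ofRealCLM.hasStrictFDerivAt).comp (ν, θ) hasStrictFDerivAt_snd
  have h3 := (h2.mul_const I).cexp
  have h4 := h3.mul h1
  refine ⟨_, h4, ?_⟩
  intro z t
  simp
  ring

lemma open_at {θ : ℝ} {ν : ℂ} (h : ν ∈ Om) (hs : Sol θ ν) :
    ∀ᶠ t in nhds θ, ∃ μ ∈ Om, Sol t μ := by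
  have hF := strict_of (F := Ff) (fun ν hν => hasDerivAt_Ff hν) h.2.1
  have hG := strict_of (F := Gf) (fun ν hν => hasDerivAt_Gf hν) h.2.1
  obtain ⟨L, hL, eL⟩ := strict_prod θ hF
  obtain ⟨M, hM, eM⟩ := strict_prod θ hG
  have h1 := (reCLM.hasStrictFDerivAt).comp (ν, θ) hL
  have h2 := (imCLM.hasStrictFDerivAt).comp (ν, θ) hM
  have h3 := (h1.prodMk h2).prodMk (hasStrictFDerivAt_snd (𝕜 := ℝ) (E := ℂ) (F := ℝ) (p := (ν, θ)))
  have hsurj : (((reCLM.comp L).prod (imCLM.comp M)).prod (ContinuousLinearMap.snd ℝ ℂ ℝ)).range = ⊤ := by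
    rw [LinearMap.range_eq_top]
    rintro ⟨⟨a, b⟩, t⟩
    have hR : ((starRingEnd ℂ) (exp (θ * I) * (-3 * ν * kV ν)) * (exp (θ * I) * (3 * ν * kW ν))).re ≠ 0 := by
      rw [conj_exp_mul]
      have e : (starRingEnd ℂ) (-3 * ν * kV ν) * (3 * ν * kW ν) =
          ((-9 * normSq ν : ℝ) : ℂ) * ((starRingEnd ℂ) (kV ν) * kW ν) := by
        simp only [map_mul, map_neg, map_ofNat]
        push_cast
        rw [normSq_eq_conj_mul_self]; ring
      rw [e, re_ofReal_mul]
      have p1 := cone_mul_pos (kV_cone h.2.1 h.1.le) (kW_cone h.2.1 h.2.2)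
      have p2 : 0 < normSq ν := normSq_pos.2 (ne_of_im_pos h.2.1)
      have := mul_pos p2 p1
      nlinarith
    obtain ⟨z, hz1, hz2⟩ := solve_lin _ _ hR (a - ((t:ℂ) * L (0, 1)).re) (b - ((t:ℂ) * M (0, 1)).im)
    refine ⟨(z, t), ?_⟩
    have q1 : (L (z, t)).re = a := by rw [eL, add_re, hz1]; ring
    have q2 : (M (z, t)).im = b := by rw [eM, add_im, hz2]; ring
    simp [q1, q2]
  have hmap := h3.map_nhds_eq_of_surj hsurj
  have hmem : {p : ℂ × ℝ | p.1 ∈ Om} ∈ nhds (ν, θ) :=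
    continuous_fst.continuousAt.preimage_mem_nhds (isOpen_Om.mem_nhds h)
  have himg := Filter.image_mem_map (m := fun p : ℂ × ℝ =>
    (((exp ((p.2 : ℂ) * I) * Ff p.1).re, (exp ((p.2 : ℂ) * I) * Gf p.1).im), p.2)) hmem
  have hmap' : Filter.map (fun p : ℂ × ℝ =>
    (((exp ((p.2 : ℂ) * I) * Ff p.1).re, (exp ((p.2 : ℂ) * I) * Gf p.1).im), p.2)) (nhds (ν, θ))
    = nhds (((0:ℝ), (0:ℝ)), θ) := by
    refine hmap.trans ?_
    congr 1
    simp [hs.1, hs.2]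
  rw [hmap'] at himg
  have hct : Continuous (fun t : ℝ => (((0:ℝ), (0:ℝ)), t)) := by fun_prop
  have := hct.continuousAt.preimage_mem_nhds himg
  filter_upwards [this] with t ht
  obtain ⟨p, hp, he⟩ := ht
  simp only [Prod.mk.injEq] at he
  obtain ⟨⟨e1, e2⟩, e3⟩ := he
  exact ⟨p.1, hp, by rw [← e3]; exact ⟨e1, e2⟩⟩

lemma Kc_compact : IsCompact Kc := by
  apply Metric.isCompact_of_isClosed_isBounded
  · have h1 : IsClosed {ν : ℂ | 0 ≤ ν.re} := isClosed_le continuous_const continuous_re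
    have h2 : IsClosed {ν : ℂ | 0 ≤ ν.im} := isClosed_le continuous_const continuous_im
    have h3 : IsClosed {ν : ℂ | ‖ν‖ ≤ 1 / 2} := isClosed_le continuous_norm continuous_const
    exact h1.inter (h2.inter h3)
  · refine (Metric.isBounded_closedBall (x := (0:ℂ)) (r := 1 / 2)).subset ?_
    intro ν hν
    simpa using hν.2.2

lemma Ff_contKc : ContinuousOn Ff Kc := Ff_contOn.mono (fun _ h => h.2.2)
lemma Gf_contKc : ContinuousOn Gf Kc := fun _ h => (Gf_cont (Or.inl h.1)).continuousWithinAt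

/-- the set of solvable angles -/
def Sset : Set ℝ := {θ | θ ∈ Ioo Real.pi (3 * Real.pi / 2) ∧ ∃ ν ∈ Om, Sol θ ν}

lemma isOpen_Sset : IsOpen Sset := by
  rw [isOpen_iff_mem_nhds]
  rintro θ ⟨hθ, ν, hν, hs⟩
  filter_upwards [open_at hν hs, isOpen_Ioo.mem_nhds hθ] with t h1 h2
  exact ⟨h2, h1⟩

lemma closed_Sset : closure Sset ∩ Ioo Real.pi (3 * Real.pi / 2) ⊆ Sset := by
  set Z : Set (ℂ × ℝ) := (Kc ×ˢ Icc Real.pi (3 * Real.pi / 2)) ∩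
    (fun p : ℂ × ℝ => ((exp ((p.2 : ℂ) * I) * Ff p.1).re, (exp ((p.2 : ℂ) * I) * Gf p.1).im)) ⁻¹' {(0, 0)} with hZ
  have hcomp : IsCompact (Kc ×ˢ Icc Real.pi (3 * Real.pi / 2)) := Kc_compact.prod isCompact_Icc
  have hcl : IsClosed Z := by
    refine ContinuousOn.preimage_isClosed_of_isClosed ?_ hcomp.isClosed isClosed_singleton
    have c1 : ContinuousOn (fun p : ℂ × ℝ => Ff p.1) (Kc ×ˢ Icc Real.pi (3 * Real.pi / 2)) :=
      Ff_contKc.comp continuous_fst.continuousOn (fun p hp => hp.1)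
    have c2 : ContinuousOn (fun p : ℂ × ℝ => Gf p.1) (Kc ×ˢ Icc Real.pi (3 * Real.pi / 2)) :=
      Gf_contKc.comp continuous_fst.continuousOn (fun p hp => hp.1)
    have c3 : ContinuousOn (fun p : ℂ × ℝ => exp ((p.2 : ℂ) * I)) (Kc ×ˢ Icc Real.pi (3 * Real.pi / 2)) := by
      fun_prop
    exact (continuous_re.comp_continuousOn (c3.mul c1)).prodMk (continuous_im.comp_continuousOn (c3.mul c2))
  have hZc : IsCompact Z := hcomp.of_isClosed_subset hcl inter_subset_left
  have himc : IsClosed (Prod.snd '' Z) := (hZc.image continuous_snd).isClosed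
  have hsub : Sset ⊆ Prod.snd '' Z := by
    rintro θ ⟨hθ, ν, hν, hs⟩
    refine ⟨(ν, θ), ⟨⟨⟨hν.1.le, hν.2.1.le, hν.2.2.le⟩, Ioo_subset_Icc_self hθ⟩, ?_⟩, rfl⟩
    exact Prod.ext hs.1 hs.2
  rintro θ ⟨h1, h2⟩
  obtain ⟨⟨ν, t⟩, ⟨⟨hk, _⟩, he⟩, rfl⟩ := closure_minimal hsub himc h1
  simp only [mem_preimage, mem_singleton_iff, Prod.mk.injEq] at he
  have hs : Sol t ν := ⟨he.1, he.2⟩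
  exact ⟨h2, ν, sol_boundary h2 hk hs, hs⟩

lemma Q_zero_sign {ν : ℂ} (h : ν ∈ Om) (hQ : ((starRingEnd ℂ) (Ff ν) * Gf ν).re = 0) :
    0 < (Ff ν).re ∧ 0 < (Ff ν).im := by
  have hft := Ft_cone h.2.1 h.2.2
  have hr := ray h.2.1 (fun s hs => cone_mul_pos hft (kV_cone
    (by rw [im_ofReal_mul]; exact mul_pos hs.1 h.2.1)
    (by rw [re_ofReal_mul]; exact (mul_pos hs.1 h.1).le)))
  have hG := (Gf_real (ν := 0) (by simp) (by simp) (by simp)).1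
  rw [hQ] at hr
  have hre : 0 < (Ff ν).re := by
    by_contra hn
    push Not at hn
    nlinarith [mul_nonneg (neg_nonneg.2 hn) hG.le]
  refine ⟨hre, ?_⟩
  have hb := Ft_im_nonneg h.2.1 h.1.le
  have ha := Ft_re_pos h.2.1
  have hw : 0 < (ν ^ 2).im := by
    rw [sq, mul_im]; nlinarith [mul_pos h.1 h.2.1]
  have e : Ff ν = ((3 : ℝ) : ℂ) * (ν ^ 2 * Ft ν) := by rw [Ff]; push_cast; ring
  rw [e, re_ofReal_mul, mul_re] at hre
  rw [e, im_ofReal_mul, mul_im]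
  have h1 : 0 < (ν ^ 2).re := by
    by_contra hn
    push Not at hn
    nlinarith [mul_nonneg hw.le hb, mul_nonneg (neg_nonneg.2 hn) ha.le]
  have := mul_pos hw ha
  have := mul_nonneg h1.le hb
  linarith

lemma exists_Q_zero : ∃ ν ∈ Om, ((starRingEnd ℂ) (Ff ν) * Gf ν).re = 0 := by
  set p : ℝ → ℂ := fun χ => ((1 / 4 : ℝ) : ℂ) * exp (χ * I) with hp
  have pre : ∀ χ, (p χ).re = 1 / 4 * Real.cos χ := fun χ => by
    rw [hp]; simp only []; rw [re_ofReal_mul, exp_ofReal_mul_I_re]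
  have pim : ∀ χ, (p χ).im = 1 / 4 * Real.sin χ := fun χ => by
    rw [hp]; simp only []; rw [im_ofReal_mul, exp_ofReal_mul_I_im]
  have pn : ∀ χ, ‖p χ‖ = 1 / 4 := fun χ => by
    rw [hp]; simp only []; rw [norm_mul, norm_exp_ofReal_mul_I, norm_real, Real.norm_eq_abs]; norm_num
  have hK : ∀ χ ∈ Icc 0 (Real.pi / 2), p χ ∈ Kc := by
    intro χ hχ
    refine ⟨?_, ?_, ?_⟩
    · rw [pre]; have := Real.cos_nonneg_of_mem_Icc (x := χ) ⟨by linarith [hχ.1, pi2_pos], hχ.2⟩; positivity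
    · rw [pim]; have := Real.sin_nonneg_of_nonneg_of_le_pi hχ.1 (by linarith [hχ.2, pi2_pos]); positivity
    · rw [pn]; norm_num
  have hpc : Continuous p := by rw [hp]; fun_prop
  have hc : ContinuousOn (fun χ => ((starRingEnd ℂ) (Ff (p χ)) * Gf (p χ)).re) (Icc 0 (Real.pi / 2)) := by
    have c1 := Ff_contKc.comp hpc.continuousOn hK
    have c2 := Gf_contKc.comp hpc.continuousOn hK
    exact continuous_re.comp_continuousOn ((continuous_conj.comp_continuousOn c1).mul c2)
  have h0 : 0 < ((starRingEnd ℂ) (Ff (p 0)) * Gf (p 0)).re := by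
    have i0 : (p 0).im = 0 := by rw [pim]; simp
    have r0 : (p 0).re = 1 / 4 := by rw [pre]; simp
    obtain ⟨a, b⟩ := Ff_real (ν := p 0) (by rw [pn]; norm_num) i0 (by rw [r0]; norm_num)
    obtain ⟨a', b'⟩ := Gf_real (ν := p 0) (by rw [r0]; norm_num) i0 (by rw [r0]; norm_num)
    rw [mul_re, conj_re, conj_im, b, b']
    have := mul_pos a a'
    linarith
  have h1 : ((starRingEnd ℂ) (Ff (p (Real.pi / 2))) * Gf (p (Real.pi / 2))).re < 0 := by
    have i0 : (p (Real.pi / 2)).im = 1 / 4 := by rw [pim]; simp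
    have r0 : (p (Real.pi / 2)).re = 0 := by rw [pre]; simp
    have hi : 0 < (p (Real.pi / 2)).im := by rw [i0]; norm_num
    refine caseA hi r0.le (Or.inr ?_)
    have e : Ff (p (Real.pi / 2)) = ((-(3 / 16) : ℝ) : ℂ) * Ft (p (Real.pi / 2)) := by
      have e1 : (p (Real.pi / 2)) ^ 2 = ((-(1 / 16) : ℝ) : ℂ) := by
        apply Complex.ext
        · rw [sq, mul_re, i0, r0, ofReal_re]; norm_num
        · rw [sq, mul_im, i0, r0, ofReal_im]; norm_num
      rw [Ff, e1]; push_cast; ring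
    rw [e, re_ofReal_mul]
    have := Ft_re_pos hi
    linarith
  obtain ⟨χ, hχ, hz⟩ := intermediate_value_Icc' pi2_pos.le hc ⟨h1.le, h0.le⟩
  simp only [] at hz
  have n0 : χ ≠ 0 := by rintro rfl; linarith
  have n1 : χ ≠ Real.pi / 2 := by rintro rfl; linarith
  have l0 := lt_of_le_of_ne hχ.1 n0.symm
  have l1 := lt_of_le_of_ne hχ.2 n1
  refine ⟨p χ, ⟨?_, ?_, ?_⟩, hz⟩
  · rw [pre]; have := Real.cos_pos_of_mem_Ioo (x := χ) ⟨by linarith [pi2_pos], l1⟩; positivity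
  · rw [pim]; have := Real.sin_pos_of_pos_of_lt_pi l0 (by linarith [pi2_pos]); positivity
  · rw [pn]; norm_num

lemma Sset_nonempty : (Ioo Real.pi (3 * Real.pi / 2) ∩ Sset).Nonempty := by
  obtain ⟨ν, hν, hQ⟩ := exists_Q_zero
  obtain ⟨hr, hi⟩ := Q_zero_sign hν hQ
  have a1 := (arg_mem_of_im_pos hi).1
  have a2 : arg (Ff ν) < Real.pi / 2 := by
    have := (abs_arg_lt_pi_div_two_iff (z := Ff ν)).2 (Or.inl hr)
    exact (abs_lt.1 this).2
  have hm : 3 * Real.pi / 2 - arg (Ff ν) ∈ Ioo Real.pi (3 * Real.pi / 2) :=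
    ⟨by linarith, by linarith⟩
  have hn : 0 < ‖Ff ν‖ := norm_pos_iff.2 (ne_of_im_pos hi)
  have hcf : exp ((3 * Real.pi / 2 - arg (Ff ν) : ℝ) * I) * Ff ν = -(‖Ff ν‖ * I) := by
    conv_lhs => rw [polar (Ff ν)]
    have harg : arg ((‖Ff ν‖ : ℂ) * exp ((arg (Ff ν) : ℝ) * I)) = arg (Ff ν) := by rw [← polar]
    rw [harg]
    have e3 : exp ((3 * Real.pi / 2 - arg (Ff ν) : ℝ) * I) * exp ((arg (Ff ν) : ℝ) * I) = -I := by
      rw [← exp_add, ← add_mul, ← ofReal_add]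
      have : 3 * Real.pi / 2 - arg (Ff ν) + arg (Ff ν) = Real.pi + Real.pi / 2 := by ring
      rw [this]; push_cast
      rw [add_mul, exp_add, exp_pi_mul_I, exp_pi_div_two_mul_I]; ring
    linear_combination (‖Ff ν‖ : ℂ) * e3
  refine ⟨_, hm, hm, ν, hν, ?_, ?_⟩
  · rw [hcf]; simp
  · have h := conj_exp_mul (3 * Real.pi / 2 - arg (Ff ν)) (Ff ν) (Gf ν)
    rw [hcf] at h
    have h2 := congrArg Complex.re h
    rw [hQ] at h2
    simp only [map_neg, map_mul, conj_ofReal, conj_I, mul_neg, neg_neg] at h2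
    rw [mul_assoc, re_ofReal_mul, I_mul_re] at h2
    rcases mul_eq_zero.1 h2 with h3 | h3
    · exact absurd h3 hn.ne'
    · linarith

theorem exists_sol {θ : ℝ} (hθ : θ ∈ Ioo Real.pi (3 * Real.pi / 2)) : ∃ ν ∈ Om, Sol θ ν :=
  ((isPreconnected_Ioo.subset_of_closure_inter_subset isOpen_Sset Sset_nonempty closed_Sset) hθ).2

lemma sin_image : Real.sin '' Ioo 0 (Real.pi / 2) = Ioo 0 1 := by
  ext x
  constructor
  · rintro ⟨θ, hθ, rfl⟩
    refine ⟨Real.sin_pos_of_pos_of_lt_pi hθ.1 (by linarith [hθ.2, pi2_pos]), ?_⟩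
    have h1 := cos_pos' hθ
    have h2 := Real.sin_sq_add_cos_sq θ
    nlinarith
  · intro hx
    refine ⟨Real.arcsin x, ⟨Real.arcsin_pos.2 hx.1, Real.arcsin_lt_pi_div_two.2 hx.2⟩, ?_⟩
    exact Real.sin_arcsin (by linarith [hx.1]) hx.2.le

lemma subst_sin (g : ℝ → ℂ) : ∫ t in (0:ℝ)..1, g t =
    ∫ θ in Ioo 0 (Real.pi / 2), |Real.cos θ| • g (Real.sin θ) := by
  rw [intervalIntegral.integral_of_le zero_le_one, integral_Ioc_eq_integral_Ioo, ← sin_image]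
  apply integral_image_eq_integral_abs_deriv_smul measurableSet_Ioo
  · intro x _
    exact (Real.hasDerivAt_sin x).hasDerivWithinAt
  · intro x hx y hy hxy
    exact Real.injOn_sin ⟨by linarith [hx.1, pi2_pos], hx.2.le⟩ ⟨by linarith [hy.1, pi2_pos], hy.2.le⟩ hxy

/-- the radicand -/
noncomputable def Df (m : ℂ) (θ : ℝ) : ℂ := 1 - m * ((Real.sin θ ^ 2 : ℝ) : ℂ)

lemma Df_re (m : ℂ) (θ : ℝ) : (Df m θ).re = 1 - m.re * Real.sin θ ^ 2 := by
  unfold Df; rw [sub_re, one_re, mul_re, ofReal_re, ofReal_im]; ring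
lemma Df_im (m : ℂ) (θ : ℝ) : (Df m θ).im = - m.im * Real.sin θ ^ 2 := by
  unfold Df; rw [sub_im, one_im, mul_im, ofReal_re, ofReal_im]; ring

lemma Df_slit {m : ℂ} (h : m.im ≠ 0) (θ : ℝ) : Df m θ ∈ slitPlane := by
  rw [mem_slitPlane_iff, Df_re, Df_im]
  by_cases hs : Real.sin θ = 0
  · left; rw [hs]; norm_num
  · right; exact mul_ne_zero (neg_ne_zero.2 h) (pow_ne_zero _ hs)

lemma cont_rtD {m : ℂ} (h : m.im ≠ 0) : Continuous (fun θ => rt (Df m θ)) := by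
  have hc : Continuous (fun θ => Df m θ) := by unfold Df; fun_prop
  exact continuousOn_rt.comp_continuous hc (fun θ => Df_slit h θ)

lemma rtD_ne {m : ℂ} (h : m.im ≠ 0) (θ : ℝ) : rt (Df m θ) ≠ 0 :=
  rt_ne_zero (slitPlane_ne_zero (Df_slit h θ))

lemma cont_rtD_inv {m : ℂ} (h : m.im ≠ 0) : Continuous (fun θ => (rt (Df m θ))⁻¹) :=
  (cont_rtD h).inv₀ (rtD_ne h)

lemma ellipticK_eq {k m : ℂ} (hm : k ^ 2 = m) (h : m.im ≠ 0) :
    ellipticK k = ∫ θ in (0:ℝ)..(Real.pi / 2), (rt (Df m θ))⁻¹ := by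
  unfold ellipticK
  rw [subst_sin, intervalIntegral.integral_of_le pi2_pos.le, integral_Ioc_eq_integral_Ioo]
  refine setIntegral_congr_fun measurableSet_Ioo (fun θ hθ => ?_)
  have hc := cos_pos' hθ
  have hcc : (Real.cos θ : ℂ) ≠ 0 := by exact_mod_cast hc.ne'
  have e : (1 - (Real.sin θ : ℂ) ^ 2) * (1 - k ^ 2 * (Real.sin θ : ℂ) ^ 2) =
      ((Real.cos θ : ℂ) * rt (Df m θ)) ^ 2 := by
    rw [mul_pow, rt_sq, sc1, hm, Df]; push_cast; ring
  have e2 := rt_unique e.symm (by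
    rw [re_ofReal_mul]; exact mul_pos hc (rt_re_pos (Df_slit h θ)))
  unfold rt at e2
  rw [e2, abs_of_pos hc, real_smul]
  have h0 := rtD_ne h θ
  unfold rt at h0 ⊢
  field_simp

lemma ellipticE_eq {k m : ℂ} (hm : k ^ 2 = m) (h : m.im ≠ 0) :
    ellipticE k = ∫ θ in (0:ℝ)..(Real.pi / 2), rt (Df m θ) := by
  unfold ellipticE
  rw [subst_sin, intervalIntegral.integral_of_le pi2_pos.le, integral_Ioc_eq_integral_Ioo]
  refine setIntegral_congr_fun measurableSet_Ioo (fun θ hθ => ?_)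
  have hc := cos_pos' hθ
  have hcc : (Real.cos θ : ℂ) ≠ 0 := by exact_mod_cast hc.ne'
  have e : (1 - k ^ 2 * (Real.sin θ : ℂ) ^ 2) / (1 - (Real.sin θ : ℂ) ^ 2) =
      (((Real.cos θ)⁻¹ : ℝ) * rt (Df m θ)) ^ 2 := by
    rw [mul_pow, rt_sq, ← sc1, hm, Df]; push_cast [-ofReal_cos, -ofReal_sin]; field_simp
  have e2 := rt_unique e.symm (by
    rw [re_ofReal_mul]; exact mul_pos (inv_pos.2 hc) (rt_re_pos (Df_slit h θ)))
  unfold rt at e2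
  rw [e2, abs_of_pos hc, real_smul]
  push_cast [-ofReal_cos, -ofReal_sin]
  unfold rt
  field_simp

lemma hasDerivAt_Df (m : ℂ) (θ : ℝ) :
    HasDerivAt (fun t => Df m t) (-(m * ((2 * (Real.sin θ * Real.cos θ) : ℝ) : ℂ))) θ := by
  have h2 : HasDerivAt (fun t : ℝ => Real.sin t ^ 2) (2 * (Real.sin θ * Real.cos θ)) θ := by
    have := (Real.hasDerivAt_sin θ).pow 2
    exact this.congr_deriv (by simp; ring)
  exact (h2.ofReal_comp.const_mul m).const_sub 1

lemma hasDerivAt_sc (θ : ℝ) : HasDerivAt (fun t : ℝ => ((Real.sin t * Real.cos t : ℝ) : ℂ))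
    ((Real.cos θ ^ 2 - Real.sin θ ^ 2 : ℝ) : ℂ) θ := by
  apply HasDerivAt.ofReal_comp
  exact ((Real.hasDerivAt_sin θ).mul (Real.hasDerivAt_cos θ)).congr_deriv (by ring)

/-- derivative of `sin cos √D` -/
lemma hasDerivAt_H {m : ℂ} (h : m.im ≠ 0) (θ : ℝ) :
    HasDerivAt (fun t : ℝ => ((Real.sin t * Real.cos t : ℝ) : ℂ) * rt (Df m t))
      ((((Real.cos θ ^ 2 - Real.sin θ ^ 2 : ℝ) : ℂ) * Df m θ
        - m * ((Real.sin θ ^ 2 * Real.cos θ ^ 2 : ℝ) : ℂ)) * (rt (Df m θ))⁻¹) θ := by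
  have h1 : HasDerivAt (fun t : ℝ => rt (Df m t))
      (1 / (2 * rt (Df m θ)) * (-(m * ((2 * (Real.sin θ * Real.cos θ) : ℝ) : ℂ)))) θ :=
    (hasDerivAt_rt (Df_slit h θ)).comp θ (hasDerivAt_Df m θ)
  refine ((hasDerivAt_sc θ).mul h1).congr_deriv ?_
  have h0 := rtD_ne h θ
  have hq := rt_sq' (Df m θ)
  generalize rt (Df m θ) = r at *
  rw [← hq]
  push_cast [-ofReal_cos, -ofReal_sin]
  field_simp
  ring

lemma int_H {m : ℂ} (h : m.im ≠ 0) : ∫ θ in (0:ℝ)..(Real.pi / 2),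
      ((((Real.cos θ ^ 2 - Real.sin θ ^ 2 : ℝ) : ℂ) * Df m θ
        - m * ((Real.sin θ ^ 2 * Real.cos θ ^ 2 : ℝ) : ℂ)) * (rt (Df m θ))⁻¹) = 0 := by
  have hcD : Continuous (fun θ => Df m θ) := by unfold Df; fun_prop
  rw [intervalIntegral.integral_eq_sub_of_hasDerivAt (fun θ _ => hasDerivAt_H h θ)]
  · simp
  · apply Continuous.intervalIntegrable
    exact Continuous.mul (by fun_prop) (cont_rtD_inv h)

lemma B_eq {m : ℂ} (h : m.im ≠ 0) :
    (m - 1) * (∫ θ in (0:ℝ)..(Real.pi / 2), (rt (Df m θ))⁻¹) +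
      (1 + m) * (∫ θ in (0:ℝ)..(Real.pi / 2), rt (Df m θ)) =
    3 * m * ∫ θ in (0:ℝ)..(Real.pi / 2), ((Real.cos θ ^ 2 : ℝ) : ℂ) * rt (Df m θ) := by
  have hcD : Continuous (fun θ => Df m θ) := by unfold Df; fun_prop
  have c1 := cont_rtD h
  have c2 := cont_rtD_inv h
  have key : (m - 1) * (∫ θ in (0:ℝ)..(Real.pi / 2), (rt (Df m θ))⁻¹) +
      (1 + m) * (∫ θ in (0:ℝ)..(Real.pi / 2), rt (Df m θ)) -
      3 * m * (∫ θ in (0:ℝ)..(Real.pi / 2), ((Real.cos θ ^ 2 : ℝ) : ℂ) * rt (Df m θ))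
      = (-m) * ∫ θ in (0:ℝ)..(Real.pi / 2),
      ((((Real.cos θ ^ 2 - Real.sin θ ^ 2 : ℝ) : ℂ) * Df m θ
        - m * ((Real.sin θ ^ 2 * Real.cos θ ^ 2 : ℝ) : ℂ)) * (rt (Df m θ))⁻¹) := by
    rw [← intervalIntegral.integral_const_mul, ← intervalIntegral.integral_const_mul,
      ← intervalIntegral.integral_const_mul, ← intervalIntegral.integral_const_mul,
      ← intervalIntegral.integral_add, ← intervalIntegral.integral_sub]
    · congr 1
      ext θ
      have h0 := rtD_ne h θ
      have hq := rt_sq' (Df m θ)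
      have hD : Df m θ = 1 - m * (Real.sin θ : ℂ) ^ 2 := by unfold Df; push_cast; rfl
      have hc := sc1 θ
      rw [hD] at hq h0 ⊢
      generalize rt _ = r at *
      push_cast [-ofReal_cos, -ofReal_sin]
      rw [hc]
      field_simp
      linear_combination (1 + m - 3 * m * (1 - (Real.sin θ : ℂ) ^ 2)) * hq
    all_goals apply Continuous.intervalIntegrable; fun_prop
  rw [int_H h, mul_zero] at key
  exact sub_eq_zero.1 key

lemma A_eq {m : ℂ} (h : (1 - m).im ≠ 0) :
    -2 * m * (∫ θ in (0:ℝ)..(Real.pi / 2), (rt (Df (1 - m) θ))⁻¹) +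
      (1 + m) * (∫ θ in (0:ℝ)..(Real.pi / 2), rt (Df (1 - m) θ)) =
    3 * (1 - m) ^ 2 * ∫ θ in (0:ℝ)..(Real.pi / 2),
      ((Real.sin θ ^ 2 * Real.cos θ ^ 2 : ℝ) : ℂ) * (rt (Df (1 - m) θ))⁻¹ := by
  have hcD : Continuous (fun θ => Df (1 - m) θ) := by unfold Df; fun_prop
  have c1 := cont_rtD h
  have c2 := cont_rtD_inv h
  have key : -2 * m * (∫ θ in (0:ℝ)..(Real.pi / 2), (rt (Df (1 - m) θ))⁻¹) +
      (1 + m) * (∫ θ in (0:ℝ)..(Real.pi / 2), rt (Df (1 - m) θ)) -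
    3 * (1 - m) ^ 2 * (∫ θ in (0:ℝ)..(Real.pi / 2),
      ((Real.sin θ ^ 2 * Real.cos θ ^ 2 : ℝ) : ℂ) * (rt (Df (1 - m) θ))⁻¹)
      = (1 - m) * ∫ θ in (0:ℝ)..(Real.pi / 2),
      ((((Real.cos θ ^ 2 - Real.sin θ ^ 2 : ℝ) : ℂ) * Df (1 - m) θ
        - (1 - m) * ((Real.sin θ ^ 2 * Real.cos θ ^ 2 : ℝ) : ℂ)) * (rt (Df (1 - m) θ))⁻¹) := by
    rw [← intervalIntegral.integral_const_mul, ← intervalIntegral.integral_const_mul,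
      ← intervalIntegral.integral_const_mul, ← intervalIntegral.integral_const_mul,
      ← intervalIntegral.integral_add, ← intervalIntegral.integral_sub]
    · congr 1
      ext θ
      have h0 := rtD_ne h θ
      have hq := rt_sq' (Df (1 - m) θ)
      have hD : Df (1 - m) θ = 1 - (1 - m) * (Real.sin θ : ℂ) ^ 2 := by unfold Df; push_cast; rfl
      have hc := sc1 θ
      rw [hD] at hq h0 ⊢
      generalize rt _ = r at *
      push_cast [-ofReal_cos, -ofReal_sin]
      rw [hc]
      field_simp
      linear_combination (1 + m) * hq
    all_goals apply Continuous.intervalIntegrable; fun_prop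
  rw [int_H h, mul_zero] at key
  exact sub_eq_zero.1 key

/-- the change of parameter -/
noncomputable def nu (m : ℂ) : ℂ := (1 + m)⁻¹ - 1 / 2

lemma onem_ne {m : ℂ} (hr : 0 < (1 + m).re) : 1 + m ≠ 0 := by
  intro h; rw [h] at hr; simp at hr

lemma nu_im {m : ℂ} (hi : m.im < 0) (hr : 0 < (1 + m).re) : 0 < (nu m).im := by
  have hn : 0 < normSq (1 + m) := normSq_pos.2 (onem_ne hr)
  have e : (nu m).im = - m.im / normSq (1 + m) := by
    unfold nu; rw [sub_im, inv_im]; simp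
  rw [e]
  exact div_pos (by linarith) hn

/-- the square root of `(1+m)⁻¹` -/
noncomputable def nn (m : ℂ) : ℂ := exp (-(log (1 + m) / 2))

lemma nn_sq {m : ℂ} (hr : 0 < (1 + m).re) : nn m ^ 2 = (1 + m)⁻¹ := by
  unfold nn
  rw [← exp_nat_mul]
  have : ((2 : ℕ) : ℂ) * -(log (1 + m) / 2) = -log (1 + m) := by push_cast; ring
  rw [this, exp_neg, exp_log (onem_ne hr)]

lemma nn_pos {m : ℂ} (hi : m.im < 0) (hr : 0 < (1 + m).re) : 0 < (nn m).re ∧ 0 < (nn m).im := by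
  have hi' : (1 + m).im < 0 := by simpa using hi
  have h1 : arg (1 + m) < 0 := arg_neg_iff.2 hi'
  have h2 := abs_lt.1 ((abs_arg_lt_pi_div_two_iff (z := 1 + m)).2 (Or.inl hr))
  have e : (-(log (1 + m) / 2)).im = -(arg (1 + m) / 2) := by
    rw [neg_im, div_ofNat_im, log_im]
  unfold nn
  rw [exp_re, exp_im, e]
  have hpi := Real.pi_pos
  constructor
  · exact mul_pos (Real.exp_pos _) (Real.cos_pos_of_mem_Ioo ⟨by linarith, by linarith⟩)
  · exact mul_pos (Real.exp_pos _) (Real.sin_pos_of_pos_of_lt_pi (by linarith) (by linarith))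

lemma rtW_eq {m : ℂ} (hi : m.im < 0) (hr : 0 < (1 + m).re) (θ : ℝ) :
    rt (Wf (nu m) θ) = nn m * rt (Df (1 - m) θ) := by
  obtain ⟨n1, n2⟩ := nn_pos hi hr
  have him : (1 - m).im ≠ 0 := by simp; exact hi.ne
  apply rt_unique
  · rw [mul_pow, nn_sq hr, rt_sq, Df, Wf, nu, Real.cos_two_mul]
    have h0 := onem_ne hr
    push_cast [-ofReal_cos, -ofReal_sin]
    rw [sc1]
    field_simp
    ring
  · have h1 := rt_re_pos (Df_slit him θ)
    have h2 := rt_im_nonpos (Df_slit him θ) (by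
      rw [Df_im, sub_im, one_im]; nlinarith [sq_nonneg (Real.sin θ)])
    rw [mul_re]
    nlinarith [mul_pos n1 h1, mul_nonneg n2.le (neg_nonneg.2 h2)]

lemma rtV_eq {m : ℂ} (hi : m.im < 0) (hr : 0 < (1 + m).re) (θ : ℝ) :
    rt (Vf (nu m) θ) = nn m * rt (Df m θ) := by
  obtain ⟨n1, n2⟩ := nn_pos hi hr
  have e : (nn m * rt (Df m θ)) ^ 2 = Vf (nu m) θ := by
    rw [mul_pow, nn_sq hr, rt_sq, Df, Vf, nu]
    have h0 := onem_ne hr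
    push_cast [-ofReal_cos, -ofReal_sin]
    rw [sc1]
    field_simp
    ring
  refine rt_unique e ?_
  have h1 := rt_re_pos (Df_slit hi.ne θ)
  have h2 := rt_im_nonneg (Df_slit hi.ne θ) (by
      rw [Df_im]; nlinarith [sq_nonneg (Real.sin θ)])
  have h3 := Vf_im_pos (nu_im hi hr) θ
  rw [← e, sq, mul_im] at h3
  have h4 : 0 < (nn m * rt (Df m θ)).im := by
    rw [mul_im]
    nlinarith [mul_pos n2 h1, mul_nonneg n1.le h2]
  by_contra hn
  push Not at hn
  nlinarith [mul_nonneg (neg_nonneg.2 hn) h4.le]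

lemma P_eq (φ : ℝ) (m : ℂ) : exp ((3 / 2) * (I * φ - log (1 + m))) =
    exp (((3 * φ / 2 : ℝ) : ℂ) * I) * nn m ^ 3 := by
  unfold nn
  rw [← exp_nat_mul, ← exp_add]
  congr 1
  push_cast; ring

lemma PA_eq {m : ℂ} (hi : m.im < 0) (hr : 0 < (1 + m).re) :
    nn m ^ 3 * (3 * (1 - m) ^ 2 * ∫ θ in (0:ℝ)..(Real.pi / 2),
      ((Real.sin θ ^ 2 * Real.cos θ ^ 2 : ℝ) : ℂ) * (rt (Df (1 - m) θ))⁻¹) = Ff (nu m) := by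
  obtain ⟨n1, n2⟩ := nn_pos hi hr
  have hn0 := ne_of_im_pos n2
  have h0 := onem_ne hr
  have e : Ft (nu m) = (4 * (nn m)⁻¹) * ∫ θ in (0:ℝ)..(Real.pi / 2),
      ((Real.sin θ ^ 2 * Real.cos θ ^ 2 : ℝ) : ℂ) * (rt (Df (1 - m) θ))⁻¹ := by
    unfold Ft
    rw [← intervalIntegral.integral_const_mul]
    congr 1
    ext θ
    rw [rtW_eq hi hr, Real.sin_two_mul, mul_inv]
    push_cast; ring
  rw [Ff, e]
  have h4 : nn m ^ 4 = (1 + m)⁻¹ ^ 2 := by rw [← nn_sq hr]; ring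
  have h5 : nu m = (1 - m) * (1 + m)⁻¹ / 2 := by unfold nu; field_simp; ring
  generalize (∫ θ in (0:ℝ)..(Real.pi / 2),
      ((Real.sin θ ^ 2 * Real.cos θ ^ 2 : ℝ) : ℂ) * (rt (Df (1 - m) θ))⁻¹) = J
  have h6 : nn m ^ 3 = (nn m)⁻¹ * (1 + m)⁻¹ ^ 2 := by rw [← h4]; field_simp
  rw [h5, h6]; ring

lemma PB_eq {m : ℂ} (hi : m.im < 0) (hr : 0 < (1 + m).re) :
    nn m ^ 3 * (3 * m * ∫ θ in (0:ℝ)..(Real.pi / 2), ((Real.cos θ ^ 2 : ℝ) : ℂ) * rt (Df m θ))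
      = Gf (nu m) := by
  have h0 := onem_ne hr
  have e : Gt (nu m) = nn m * ∫ θ in (0:ℝ)..(Real.pi / 2),
      ((Real.cos θ ^ 2 : ℝ) : ℂ) * rt (Df m θ) := by
    unfold Gt
    rw [← intervalIntegral.integral_const_mul]
    congr 1
    ext θ
    rw [rtV_eq hi hr]
    ring
  rw [Gf, e]
  have h5 : 1 / 2 - nu m = m * (1 + m)⁻¹ := by unfold nu; field_simp; ring
  have h6 : nn m ^ 3 = nn m * (1 + m)⁻¹ := by rw [← nn_sq hr]; ring
  rw [h5, h6]; ring

lemma system_iff {φ : ℝ} {κ : ℂ} (hi : (κ ^ 2).im < 0) (hr : 0 < (1 + κ ^ 2).re) :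
    ((Complex.exp ((3 / 2) * (I * φ - Complex.log (1 + κ ^ 2))) *
        (-2 * κ ^ 2 * ellipticK ((1 - κ ^ 2) ^ ((1 : ℂ) / 2)) +
          (1 + κ ^ 2) * ellipticE ((1 - κ ^ 2) ^ ((1 : ℂ) / 2)))).re = 0 ∧
      (Complex.exp ((3 / 2) * (I * φ - Complex.log (1 + κ ^ 2))) *
        ((κ ^ 2 - 1) * ellipticK κ + (1 + κ ^ 2) * ellipticE κ)).im = 0) ↔
      Sol (3 * φ / 2) (nu (κ ^ 2)) := by
  have him : (1 - κ ^ 2).im ≠ 0 := by rw [sub_im, one_im]; linarith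
  have hsq : ((1 - κ ^ 2) ^ ((1 : ℂ) / 2)) ^ 2 = 1 - κ ^ 2 := rt_sq (1 - κ ^ 2)
  rw [ellipticK_eq hsq him, ellipticE_eq hsq him, ellipticK_eq rfl hi.ne, ellipticE_eq rfl hi.ne,
    A_eq him, B_eq hi.ne, P_eq, mul_assoc, PA_eq hi hr, mul_assoc, PB_eq hi hr, Sol]

lemma sq_im_neg {κ : ℂ} (h1 : 0 < κ.re) (h2 : κ.im < 0) : (κ ^ 2).im < 0 := by
  rw [sq, mul_im]; nlinarith [mul_neg_of_pos_of_neg h1 h2]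

lemma exists_kappa {ν : ℂ} (h : ν ∈ Om) :
    ∃ κ : ℂ, (0 < κ.re ∧ κ.im < 0 ∧ 0 < (1 + κ ^ 2).re) ∧ nu (κ ^ 2) = ν := by
  have hre : 0 < (1 / 2 + ν).re := by
    have := h.1; simp; linarith
  have him : 0 < (1 / 2 + ν).im := by
    have := h.2.1; simpa using this
  have hmi : ((1 / 2 + ν)⁻¹ - 1).im < 0 := by
    rw [sub_im, one_im, sub_zero]; exact inv_im_neg him
  have hm1 : 1 + ((1 / 2 + ν)⁻¹ - 1) = (1 / 2 + ν)⁻¹ := by ring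
  have hsl : (1 / 2 + ν)⁻¹ - 1 ∈ slitPlane := mem_slitPlane_iff.2 (Or.inr hmi.ne)
  refine ⟨rt ((1 / 2 + ν)⁻¹ - 1), ⟨rt_re_pos hsl, ?_, ?_⟩, ?_⟩
  · have h1 := rt_re_pos hsl
    have h2 := (rt_re_im ((1 / 2 + ν)⁻¹ - 1)).2
    by_contra hn
    push Not at hn
    nlinarith [mul_nonneg h1.le hn]
  · rw [rt_sq, hm1]; exact inv_re_pos hre
  · rw [rt_sq, nu, hm1, inv_inv]; ring

lemma nu_inj {m₁ m₂ : ℂ} (h : nu m₁ = nu m₂) : m₁ = m₂ := by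
  unfold nu at h
  have h1 : (1 + m₁)⁻¹ = (1 + m₂)⁻¹ := by linear_combination h
  have h2 := inv_injective h1
  linear_combination h2

end

/-- The Boutroux system in modulus form has a unique solution `κ(φ)` in the
fourth quadrant with `Re(1+κ²) > 0`, for `φ ∈ (2π/3, π)`. Here
`P = exp((3/2)(iφ − Log(1+κ²)))` and `κ' = √(1−κ²)` (principal branches). -/
theorem boutroux_system_unique_solution (φ : ℝ)
    (hφ₁ : 2 * Real.pi / 3 < φ) (hφ₂ : φ < Real.pi) :
    ∃! κ : ℂ, (0 < κ.re ∧ κ.im < 0 ∧ 0 < (1 + κ ^ 2).re) ∧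
      (Complex.exp ((3 / 2) * (I * φ - Complex.log (1 + κ ^ 2))) *
        (-2 * κ ^ 2 * ellipticK ((1 - κ ^ 2) ^ ((1 : ℂ) / 2)) +
          (1 + κ ^ 2) * ellipticE ((1 - κ ^ 2) ^ ((1 : ℂ) / 2)))).re = 0 ∧
      (Complex.exp ((3 / 2) * (I * φ - Complex.log (1 + κ ^ 2))) *
        ((κ ^ 2 - 1) * ellipticK κ + (1 + κ ^ 2) * ellipticE κ)).im = 0 := by
  have hθ : 3 * φ / 2 ∈ Set.Ioo Real.pi (3 * Real.pi / 2) := ⟨by linarith, by linarith⟩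
  obtain ⟨ν, hν, hs⟩ := exists_sol hθ
  obtain ⟨κ, hκ, he⟩ := exists_kappa hν
  refine ⟨κ, ⟨hκ, (system_iff (sq_im_neg hκ.1 hκ.2.1) hκ.2.2).2 (by rw [he]; exact hs)⟩, ?_⟩
  rintro κ' ⟨hκ', hs'⟩
  have hs2 := (system_iff (sq_im_neg hκ'.1 hκ'.2.1) hκ'.2.2).1 hs'
  have hm := sol_mem_Om hθ (nu_im (sq_im_neg hκ'.1 hκ'.2.1) hκ'.2.2) hs2
  have h1 : nu (κ' ^ 2) = nu (κ ^ 2) := by rw [he]; exact sol_unique hm hν hs2 hs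
  have h2 := nu_inj h1
  rw [← rt_unique rfl hκ'.1, ← rt_unique rfl hκ.1, h2]
end
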